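/- arXiv:1611.02070 — 9 statements merged into one kernel-verified Lean document; each statement's English description precedes it below -/
import Mathlib

section
/- Let (a,b) and (c,d) be arcs in 𝒜 with a < c ≤ b < d. Then there exists a non-split short exact sequence of graded S-modules with degree-0 maps 0 → M_{(a,b)} → B → M_{(c,d)} → 0 whose middle term B is isomorphic to M_{(c,b)} ⊕ M_{(a,d)} (where M_{(c,b)} is interpreted as the zero module if c = b). -/
/-- `𝒵 = ℤ ∪ {−∞}`. -/
abbrev Zb := WithBot ℤ

universe u

noncomputable section

/-- A `ℤ`-graded module over `S = k[y]` (`y` of degree `1`), presented as a representation of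
the companion category: a family of `k`-vector spaces `V i` (the degree-`i` homogeneous
components) together with the action of `y`, raising degrees by one. -/
structure GrMod (k : Type u) [Field k] where
  V : ℤ → Type u
  [acg : ∀ i, AddCommGroup (V i)]
  [mod : ∀ i, Module k (V i)]
  act : ∀ i, V i →ₗ[k] V (i + 1)

attribute [instance] GrMod.acg GrMod.mod

variable (k : Type u) [Field k]

/-- The degree-`i` component of the graded module `M_{(a,b)}` attached to a pair `(a,b)`:
it is `k` when `a < −i ≤ b` and `0` otherwise.  (For an arc `a < b` with `a,b ∈ ℤ` this is
the module `S/(y^{b−a})(b)`, generated in degree `−b`; for `a = −∞` it is `S(b)`; if `a = b`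
it is the zero module.) -/
def arcComp (a b : Zb) (i : ℤ) : Submodule k k :=
  if a < ((-i : ℤ) : Zb) ∧ ((-i : ℤ) : Zb) ≤ b then ⊤ else ⊥

/-- The graded module `M_{(a,b)}`: for integers `a < b` this is `S/(y^{b−a})(b)`, for
`a = −∞` it is the twisted free module `S(b)`, and for `a = b` it is the zero module.
The action of `y` is the canonical one (the identity of `k` whenever source and target
components are both nonzero). -/
def arcMod (a b : Zb) : GrMod k where
  V i := ↥(arcComp k a b i)
  act i := by
    classical
    exact if h : arcComp k a b (i + 1) = ⊤ then
      LinearMap.codRestrict _ (arcComp k a b i).subtype (fun x => by rw [h]; trivial)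
    else 0

/-- A family of degree-wise linear maps is a (degree-0) morphism of graded modules if it
commutes with the action of `y`. -/
def IsGrHom (M N : GrMod k) (f : ∀ i, M.V i →ₗ[k] N.V i) : Prop :=
  ∀ i, (N.act i).comp (f i) = (f (i + 1)).comp (M.act i)

/-- The `k`-vector space `Hom_{gr S}(M, N)` of degree-0 graded module homomorphisms. -/
def grHom (M N : GrMod k) : Submodule k (∀ i, M.V i →ₗ[k] N.V i) where
  carrier := {f | IsGrHom k M N f}
  add_mem' := by
    intro f g hf hg i
    simp only [Pi.add_apply, LinearMap.comp_add, LinearMap.add_comp, hf i, hg i]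
  zero_mem' := by
    intro i
    simp only [Pi.zero_apply, LinearMap.comp_zero, LinearMap.zero_comp]
  smul_mem' := by
    intro c f hf i
    simp only [Pi.smul_apply, LinearMap.comp_smul, LinearMap.smul_comp, hf i]

/-- An isomorphism of graded modules: a family of degree-wise linear equivalences commuting
with the action of `y`. -/
structure GrIso (M N : GrMod k) where
  e : ∀ i, M.V i ≃ₗ[k] N.V i
  comm : ∀ (i : ℤ) (x : M.V i), N.act i (e i x) = e (i + 1) (M.act i x)

/-- The kernel of a morphism of graded modules, as a graded module. -/
def kerMod (M N : GrMod k) (f : ∀ i, M.V i →ₗ[k] N.V i) (hf : IsGrHom k M N f) : GrMod k where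
  V i := ↥(LinearMap.ker (f i))
  act i := (M.act i).restrict (p := LinearMap.ker (f i)) (q := LinearMap.ker (f (i + 1)))
    (fun x hx => by
      have h := LinearMap.congr_fun (hf i) x
      simp only [LinearMap.comp_apply] at h
      simp only [LinearMap.mem_ker] at hx ⊢
      rw [← h, hx, map_zero])

/-- The cokernel of a morphism of graded modules, as a graded module. -/
def cokerMod (M N : GrMod k) (f : ∀ i, M.V i →ₗ[k] N.V i) (hf : IsGrHom k M N f) : GrMod k where
  V i := N.V i ⧸ LinearMap.range (f i)
  act i := Submodule.mapQ _ _ (N.act i) (by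
    rintro x hx
    simp only [LinearMap.mem_range] at hx
    obtain ⟨y, rfl⟩ := hx
    simp only [Submodule.mem_comap, LinearMap.mem_range]
    have h := LinearMap.congr_fun (hf i) y
    simp only [LinearMap.comp_apply] at h
    exact ⟨M.act i y, h.symm⟩)

/-- The direct sum of two graded modules. -/
def dsumMod (M N : GrMod k) : GrMod k where
  V i := M.V i × N.V i
  act i := (M.act i).prodMap (N.act i)

/-- `0 → M → B → N → 0` is a short exact sequence of graded modules (with degree-0 maps). -/
def IsGrSES (M B N : GrMod k) (ι : ∀ i, M.V i →ₗ[k] B.V i)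
    (π : ∀ i, B.V i →ₗ[k] N.V i) : Prop :=
  IsGrHom k M B ι ∧ IsGrHom k B N π ∧
    ∀ i, Function.Injective (ι i) ∧ Function.Surjective (π i) ∧
      LinearMap.ker (π i) = LinearMap.range (ι i)

/-- A short exact sequence of graded modules splits if the projection admits a degree-0
graded section. -/
def GrSplit (M B N : GrMod k) (ι : ∀ i, M.V i →ₗ[k] B.V i)
    (π : ∀ i, B.V i →ₗ[k] N.V i) : Prop :=
  ∃ σ : ∀ i, N.V i →ₗ[k] B.V i, IsGrHom k N B σ ∧ ∀ i, (π i).comp (σ i) = LinearMap.id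

end

section ArcModHelpers

variable (k : Type u) [Field k]

/-- The degree `i` lies in the support of `M_{(a,b)}`. -/
def ArcSupp (a b : Zb) (i : ℤ) : Prop :=
  a < ((-i : ℤ) : Zb) ∧ ((-i : ℤ) : Zb) ≤ b

theorem mem_arcComp_iff (a b : Zb) (i : ℤ) (x : k) :
    x ∈ arcComp k a b i ↔ (¬ ArcSupp a b i → x = 0) := by
  unfold arcComp ArcSupp
  split_ifs with h <;> simp [h]

theorem arcComp_eq_top_iff (a b : Zb) (i : ℤ) : arcComp k a b i = ⊤ ↔ ArcSupp a b i := by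
  unfold arcComp ArcSupp
  split_ifs with h <;> simp [h]

/-- The inclusion of a homogeneous component of `M_{(a,b)}` into `k`. -/
noncomputable def arcVal (a b : Zb) (i : ℤ) : (arcMod k a b).V i →ₗ[k] k := (arcComp k a b i).subtype

theorem arcVal_injective (a b : Zb) (i : ℤ) : Function.Injective (arcVal k a b i) :=
  Subtype.val_injective

theorem arcVal_eq_zero {a b : Zb} {i : ℤ} (h : ¬ ArcSupp a b i) (x : (arcMod k a b).V i) :
    arcVal k a b i x = 0 :=
  (mem_arcComp_iff k a b i _).1 x.2 h

theorem exists_arcVal_eq {a b : Zb} {i : ℤ} {r : k} (h : ¬ ArcSupp a b i → r = 0) :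
    ∃ x, arcVal k a b i x = r :=
  ⟨⟨r, (mem_arcComp_iff k a b i r).2 h⟩, rfl⟩

open Classical in
theorem arcVal_act (a b : Zb) (i : ℤ) (x : (arcMod k a b).V i) :
    arcVal k a b (i + 1) ((arcMod k a b).act i x) =
      if ArcSupp a b (i + 1) then arcVal k a b i x else 0 := by
  by_cases h : ArcSupp a b (i + 1)
  · have h' := (arcComp_eq_top_iff k a b (i + 1)).2 h
    simp only [arcMod, dif_pos h', if_pos h]
    rfl
  · rw [if_neg h, arcVal_eq_zero k h]

open Classical in
/-- The canonical degreewise map `M_{(a,b)} → M_{(a',b')}`, which is the identity of `k`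
wherever both components are nonzero. -/
noncomputable def arcCan (a b a' b' : Zb) (i : ℤ) : (arcMod k a b).V i →ₗ[k] (arcMod k a' b').V i :=
  LinearMap.codRestrict (arcComp k a' b' i)
    (if ArcSupp a' b' i then arcVal k a b i else 0) (fun x => by
      rw [mem_arcComp_iff]
      intro h
      simp [h])

open Classical in
theorem arcVal_arcCan (a b a' b' : Zb) (i : ℤ) (x : (arcMod k a b).V i) :
    arcVal k a' b' i (arcCan k a b a' b' i x) =
      if ArcSupp a' b' i then arcVal k a b i x else 0 := by
  change (if ArcSupp a' b' i then arcVal k a b i else 0) x = _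
  split_ifs <;> rfl

theorem isGrHom_arcCan {a b a' b' : Zb} (ha : a ≤ a') (hb : b ≤ b') :
    IsGrHom k (arcMod k a b) (arcMod k a' b') (arcCan k a b a' b') := by
  intro i
  ext x
  apply arcVal_injective
  simp only [LinearMap.comp_apply, arcVal_act, arcVal_arcCan]
  by_cases h : ArcSupp a b i
  · by_cases h' : ArcSupp a' b' (i + 1)
    · have hlt : ((-(i + 1) : ℤ) : Zb) < ((-i : ℤ) : Zb) := by
        rw [WithBot.coe_lt_coe]; omega
      have h1 : ArcSupp a' b' i := ⟨h'.1.trans hlt, h.2.trans hb⟩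
      have h2 : ArcSupp a b (i + 1) := ⟨ha.trans_lt h'.1, hlt.le.trans h.2⟩
      simp [h1, h2]
    · simp [h']
  · simp [arcVal_eq_zero k h]

theorem IsGrHom.prod {M N P : GrMod k} {f : ∀ i, M.V i →ₗ[k] N.V i}
    {g : ∀ i, M.V i →ₗ[k] P.V i} (hf : IsGrHom k M N f) (hg : IsGrHom k M P g) :
    IsGrHom k M (dsumMod k N P) (fun i => (f i).prod (g i)) := by
  intro i
  ext x
  exact Prod.ext (LinearMap.congr_fun (hf i) x) (LinearMap.congr_fun (hg i) x)

theorem IsGrHom.coprod_neg {M N P : GrMod k} {f : ∀ i, M.V i →ₗ[k] P.V i}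
    {g : ∀ i, N.V i →ₗ[k] P.V i} (hf : IsGrHom k M P f) (hg : IsGrHom k N P g) :
    IsGrHom k (dsumMod k M N) P (fun i => (f i).coprod (-g i)) := by
  intro i
  refine LinearMap.ext fun x => ?_
  have h1 := LinearMap.congr_fun (hf i) x.1
  have h2 := LinearMap.congr_fun (hg i) x.2
  simp only [LinearMap.comp_apply] at h1 h2
  change P.act i (f i x.1 + -(g i x.2)) =
    f (i + 1) (M.act i x.1) + -(g (i + 1) (N.act i x.2))
  rw [map_add, map_neg, h1, h2]

theorem isGrSES_arcCan {a b c d : Zb} (h1 : a < c) (h2 : c ≤ b) (h3 : b < d) :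
    IsGrSES k (arcMod k a b) (dsumMod k (arcMod k c b) (arcMod k a d)) (arcMod k c d)
      (fun i => (arcCan k a b c b i).prod (arcCan k a b a d i))
      (fun i => (arcCan k c b c d i).coprod (-arcCan k a d c d i)) := by
  refine ⟨(isGrHom_arcCan k h1.le le_rfl).prod k (isGrHom_arcCan k le_rfl h3.le),
    (isGrHom_arcCan k le_rfl h3.le).coprod_neg k (isGrHom_arcCan k h1.le le_rfl), fun i => ?_⟩
  have hab_ad : ArcSupp a b i → ArcSupp a d i := fun h => ⟨h.1, h.2.trans h3.le⟩
  have hcd_ad : ArcSupp c d i → ArcSupp a d i := fun h => ⟨h1.trans h.1, h.2⟩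
  have had : ArcSupp a d i → ArcSupp a b i ∨ ArcSupp c d i := fun h => by
    rcases le_or_gt ((-i : ℤ) : Zb) b with h' | h'
    · exact Or.inl ⟨h.1, h'⟩
    · exact Or.inr ⟨h2.trans_lt h', h.2⟩
  have hcb : ArcSupp c b i ↔ ArcSupp a b i ∧ ArcSupp c d i :=
    ⟨fun h => ⟨⟨h1.trans h.1, h.2⟩, ⟨h.1, h.2.trans h3.le⟩⟩, fun h => ⟨h.2.1, h.1.2⟩⟩
  refine ⟨fun x y hxy => ?_, fun z => ?_, ?_⟩
  · have hxy' := congrArg (arcVal k a d i) (congrArg Prod.snd hxy)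
    change arcVal k a d i (arcCan k a b a d i x) = arcVal k a d i (arcCan k a b a d i y) at hxy'
    rw [arcVal_arcCan, arcVal_arcCan] at hxy'
    apply arcVal_injective
    by_cases h : ArcSupp a b i
    · simpa [hab_ad h] using hxy'
    · rw [arcVal_eq_zero k h, arcVal_eq_zero k h]
  · obtain ⟨y, hy⟩ := exists_arcVal_eq k (a := a) (b := d) (i := i) (r := -arcVal k c d i z)
      (fun h => by rw [arcVal_eq_zero k (fun h' => h (hcd_ad h')), neg_zero])
    refine ⟨((0 : (arcMod k c b).V i), y), ?_⟩
    apply arcVal_injective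
    change arcVal k c d i (arcCan k c b c d i 0 + -(arcCan k a d c d i y)) = _
    rw [map_zero, zero_add, map_neg, arcVal_arcCan, hy]
    by_cases h : ArcSupp c d i
    · simp [h]
    · simp [h, arcVal_eq_zero k h]
  · ext ⟨x, y⟩
    have hker : (x, y) ∈ LinearMap.ker ((arcCan k c b c d i).coprod (-arcCan k a d c d i)) ↔
        (ArcSupp c d i → arcVal k c b i x = arcVal k a d i y) := by
      rw [LinearMap.mem_ker, ← (arcVal_injective k c d i).eq_iff]
      simp only [LinearMap.coprod_apply, LinearMap.neg_apply, map_add, map_neg, map_zero,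
        arcVal_arcCan]
      by_cases h : ArcSupp c d i
      · simp [h, ← sub_eq_add_neg, sub_eq_zero]
      · simp [h]
    refine hker.trans ⟨fun h => ?_, ?_⟩
    · obtain ⟨z, hz⟩ := exists_arcVal_eq k (a := a) (b := b) (i := i) (r := arcVal k a d i y)
        (fun hn => by
          by_cases hc : ArcSupp c d i
          · rw [← h hc, arcVal_eq_zero k (fun h' => hn (hcb.1 h').1)]
          · exact arcVal_eq_zero k (fun h' => (had h').elim hn hc) y)
      refine ⟨z, Prod.ext ?_ ?_⟩
      · apply arcVal_injective
        change arcVal k c b i (arcCan k a b c b i z) = arcVal k c b i x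
        rw [arcVal_arcCan, hz]
        by_cases hc : ArcSupp c b i
        · rw [if_pos hc, h (hcb.1 hc).2]
        · rw [if_neg hc, arcVal_eq_zero k hc]
      · apply arcVal_injective
        change arcVal k a d i (arcCan k a b a d i z) = arcVal k a d i y
        rw [arcVal_arcCan, hz]
        by_cases hc : ArcSupp a d i
        · rw [if_pos hc]
        · rw [if_neg hc, arcVal_eq_zero k hc]
    · rintro ⟨z, hz⟩ hc
      obtain rfl : arcCan k a b c b i z = x := congrArg Prod.fst hz
      obtain rfl : arcCan k a b a d i z = y := congrArg Prod.snd hz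
      rw [arcVal_arcCan, arcVal_arcCan, if_pos (hcd_ad hc)]
      by_cases h : ArcSupp a b i
      · rw [if_pos (hcb.2 ⟨h, hc⟩)]
      · rw [arcVal_eq_zero k h, ite_self]

/-- For `a < c` every morphism `M_{(c,d)} → M_{(a,d)}` vanishes. -/
theorem IsGrHom.arcVal_eq_zero_of_lt {a : Zb} {c d : ℤ} (h1 : a < (c : Zb))
    {f : ∀ i, (arcMod k c d).V i →ₗ[k] (arcMod k a d).V i}
    (hf : IsGrHom k (arcMod k c d) (arcMod k a d) f) (n : ℕ) :
    ∀ i : ℤ, i + n = -c → -d ≤ i → ∀ x, arcVal k a d i (f i x) = 0 := by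
  induction n with
  | zero =>
    intro i hi _ x
    have hx : x = 0 := by
      apply arcVal_injective
      rw [map_zero]
      refine arcVal_eq_zero k (fun h => ?_) x
      have := WithBot.coe_lt_coe.1 h.1
      push_cast at hi
      omega
    rw [hx, map_zero, map_zero]
  | succ n ih =>
    intro i hi hd x
    push_cast at hi
    have h := LinearMap.congr_fun (hf i) x
    simp only [LinearMap.comp_apply] at h
    have h' := congrArg (arcVal k a d (i + 1)) h
    rw [ih (i + 1) (by omega) (by omega), arcVal_act, if_pos] at h'
    · exact h'
    · exact ⟨h1.trans_le (WithBot.coe_le_coe.2 (by omega)), WithBot.coe_le_coe.2 (by omega)⟩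

theorem not_grSplit_arcCan {a b c d : Zb} (hcd : c < d) (h1 : a < c) (h3 : b < d) :
    ¬ GrSplit k (arcMod k a b) (dsumMod k (arcMod k c b) (arcMod k a d)) (arcMod k c d)
      (fun i => (arcCan k a b c b i).prod (arcCan k a b a d i))
      (fun i => (arcCan k c b c d i).coprod (-arcCan k a d c d i)) := by
  lift c to ℤ using h1.ne_bot
  lift d to ℤ using hcd.ne_bot
  rintro ⟨σ, hσ, hid⟩
  have hcd' := WithBot.coe_lt_coe.1 hcd
  have hf : IsGrHom k (arcMod k c d) (arcMod k a d)
      (fun i => (LinearMap.snd k ((arcMod k c b).V i) ((arcMod k a d).V i)).comp (σ i)) :=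
    fun i => LinearMap.ext fun x => congrArg Prod.snd (LinearMap.congr_fun (hσ i) x)
  obtain ⟨x, hx⟩ := exists_arcVal_eq k (a := c) (b := d) (i := -d) (r := 1)
    (fun h => (h ⟨by simpa using hcd, by simp⟩).elim)
  have hs := hf.arcVal_eq_zero_of_lt k h1 (d - c).toNat (-d) (by omega) le_rfl x
  change arcVal k a d (-d) (σ (-d) x).2 = 0 at hs
  have hr : arcVal k c b (-d) (σ (-d) x).1 = 0 :=
    arcVal_eq_zero k (fun h => absurd h.2 (by simpa using h3)) _
  have hπ := congrArg (arcVal k c d (-d)) (LinearMap.congr_fun (hid (-d)) x)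
  change arcVal k c d (-d) (arcCan k c b c d (-d) (σ (-d) x).1 +
    -(arcCan k a d c d (-d) (σ (-d) x).2)) = arcVal k c d (-d) x at hπ
  rw [map_add, map_neg, arcVal_arcCan, arcVal_arcCan, hs, hr, hx] at hπ
  simp at hπ

end ArcModHelpers

/-- For arcs `(a,b)` and `(c,d)` with `a < c ≤ b < d` there is a non-split
short exact sequence of graded `S`-modules `0 → M_{(a,b)} → B → M_{(c,d)} → 0` with
`B ≅ M_{(c,b)} ⊕ M_{(a,d)}` (where `M_{(c,b)} = 0` if `c = b`). -/
theorem stmt2 (k : Type u) [Field k] (a b c d : Zb) (hab : a < b) (hcd : c < d)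
    (h1 : a < c) (h2 : c ≤ b) (h3 : b < d) :
    ∃ (B : GrMod k) (ι : ∀ i, (arcMod k a b).V i →ₗ[k] B.V i)
      (π : ∀ i, B.V i →ₗ[k] (arcMod k c d).V i),
      IsGrSES k (arcMod k a b) B (arcMod k c d) ι π ∧
      ¬ GrSplit k (arcMod k a b) B (arcMod k c d) ι π ∧
      Nonempty (GrIso k B (dsumMod k (arcMod k c b) (arcMod k a d))) := by
  exact ⟨dsumMod k (arcMod k c b) (arcMod k a d), _, _, isGrSES_arcCan k h1 h2 h3,
    not_grSplit_arcCan k hcd h1 h3, ⟨⟨fun i => LinearEquiv.refl k _, fun _ _ => rfl⟩⟩⟩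
end

section
/- Let 𝒮 ⊆ 𝒜 be a saturated set of arcs and let (l,m) ∈ 𝒮 be minimal in 𝒮 with respect to the lexicographic order on arcs (where (a,b) < (c,d) iff a < c, or a = c and b < d). Then the subset 𝒮⊥(l,m) = { (a,b) ∈ 𝒮 : neither l < a ≤ m < b nor a ≤ l < b ≤ m holds } is again saturated. -/
/-- The set `𝒜` of arcs: pairs `(a,b)` with `a < b` in `𝒵`. -/
def ArcSet : Set (Zb × Zb) := {p | p.1 < p.2}

/-- The set `𝒜_f` of arcs of finite length: arcs `(a,b)` with `a ∈ ℤ`. -/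
def FinArcSet : Set (Zb × Zb) := {p | ⊥ < p.1 ∧ p.1 < p.2}

/-- A set of arcs `𝒮` is saturated if whenever `(a,b), (c,d) ∈ 𝒮` touch with
`a ≤ c ≤ b ≤ d`, each of `(a,c), (c,b), (b,d), (a,d)` which is an arc lies in `𝒮`. -/
def Saturated (S : Set (Zb × Zb)) : Prop :=
  ∀ ⦃a b c d : Zb⦄, (a, b) ∈ S → (c, d) ∈ S → a ≤ c → c ≤ b → b ≤ d →
    (a < c → (a, c) ∈ S) ∧ (c < b → (c, b) ∈ S) ∧
    (b < d → (b, d) ∈ S) ∧ (a < d → (a, d) ∈ S)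

/-- The saturation of a set of arcs: the smallest saturated subset of `𝒜` containing it. -/
def satClosure (U : Set (Zb × Zb)) : Set (Zb × Zb) :=
  ⋂₀ {S | U ⊆ S ∧ S ⊆ ArcSet ∧ Saturated S}

/-- A partition of a poset is non-crossing if whenever `a, b` lie in a common block and `c, d`
lie in a common block different from that of `a` and `b`, neither `a < c < b < d` nor
`c < a < d < b` holds. -/
def NonCrossing {Z : Type*} [PartialOrder Z] (P : Set (Set Z)) : Prop :=
  ∀ B₁ ∈ P, ∀ B₂ ∈ P, B₁ ≠ B₂ → ∀ a ∈ B₁, ∀ b ∈ B₁, ∀ c ∈ B₂, ∀ d ∈ B₂,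
    ¬(a < c ∧ c < b ∧ b < d) ∧ ¬(c < a ∧ a < d ∧ d < b)

/-- `α(B)`: the set of arcs whose endpoints lie in a common block of `B`. -/
def alphaMap (P : Set (Set Zb)) : Set (Zb × Zb) :=
  {p | p.1 < p.2 ∧ ∃ B ∈ P, p.1 ∈ B ∧ p.2 ∈ B}

/-- `φ(𝒮)(a)`: the block of `a` determined by a saturated set of arcs `𝒮`. -/
def phiBlock (S : Set (Zb × Zb)) (a : Zb) : Set Zb :=
  insert a {b | (a, b) ∈ S ∨ (b, a) ∈ S}

/-- `φ(𝒮)`: the partition of `𝒵` determined by a saturated set of arcs `𝒮`. -/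
def phiMap (S : Set (Zb × Zb)) : Set (Set Zb) :=
  {B | ∃ a : Zb, B = phiBlock S a}

/-- If `𝒮` is a saturated set of arcs and `(l,m) ∈ 𝒮` is lexicographically
minimal in `𝒮`, then the perpendicular set `𝒮⊥(l,m)` is again saturated. -/
theorem stmt7 (S : Set (Zb × Zb)) (hS : S ⊆ ArcSet) (hsat : Saturated S)
    (l m : Zb) (hlm : (l, m) ∈ S)
    (hmin : ∀ p ∈ S, l < p.1 ∨ (l = p.1 ∧ m ≤ p.2)) :
    Saturated {p ∈ S | ¬(l < p.1 ∧ p.1 ≤ m ∧ m < p.2) ∧ ¬(p.1 ≤ l ∧ l < p.2 ∧ p.2 ≤ m)} := by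
  rintro a b c d ⟨hab, hab₁, hab₂⟩ ⟨hcd, hcd₁, hcd₂⟩ hac hcb hbd
  obtain ⟨h₁, h₂, h₃, h₄⟩ := hsat hab hcd hac hcb hbd
  have hlt : a < b := hS hab
  have hlt' : c < d := hS hcd
  have hla := hmin _ hab
  have hlc := hmin _ hcd
  simp only at hab₁ hab₂ hcd₁ hcd₂ hla hlc
  refine ⟨fun h => ⟨h₁ h, ?_⟩, fun h => ⟨h₂ h, ?_⟩, fun h => ⟨h₃ h, ?_⟩, fun h => ⟨h₄ h, ?_⟩⟩ <;>
    clear h₁ h₂ h₃ h₄ hmin hsat hS hab hcd hlm <;> grind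
end

section
/- Let 𝒮 be a finite nonempty saturated set of arcs. Then there exist n ≥ 1 and arcs (l_1,m_1), …, (l_n,m_n) ∈ 𝒮 such that sat({(l_1,m_1), …, (l_n,m_n)}) = 𝒮, and for all 1 ≤ i < j ≤ n none of the following three configurations occurs: l_j ≤ l_i < m_j ≤ m_i; l_i < l_j ≤ m_i < m_j; l_j < l_i ≤ m_j < m_i. (These conditions express, via the geometric model, that the modules M_{(l_1,m_1)}, …, M_{(l_n,m_n)} form a strong exceptional collection.) -/
/-- The arcs of `S` whose left endpoint is not the right endpoint of an arc of `S`. -/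
def initialArcs (S : Set (Zb × Zb)) : Set (Zb × Zb) :=
  {p | p ∈ S ∧ ∀ c, (c, p.1) ∉ S}

theorem exists_initialArc_of_mem {S : Set (Zb × Zb)} (hfin : S.Finite) (hS : S ⊆ ArcSet)
    (hsat : Saturated S) {a b c : Zb} (hab : (a, b) ∈ S) (hca : (c, a) ∈ S) :
    ∃ m, (m, a) ∈ initialArcs S ∧ (m, b) ∈ initialArcs S := by
  have hF : {x | (x, a) ∈ S}.Finite :=
    hfin.preimage (Prod.mk_left_injective a).injOn
  obtain ⟨m, hm, hmin⟩ := Set.exists_min_image _ id hF ⟨c, hca⟩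
  have hma : m < a := hS hm
  have hlt : a < b := hS hab
  have hinit : ∀ d, (d, m) ∉ S := fun d hd => by
    have hdm : d < m := hS hd
    exact absurd (hmin d ((hsat hd hm hdm.le le_rfl hma.le).2.2.2 (hdm.trans hma)))
      (not_le.mpr hdm)
  exact ⟨m, ⟨hm, hinit⟩,
    ⟨(hsat hm hab hma.le le_rfl hlt.le).2.2.2 (hma.trans hlt), hinit⟩⟩

theorem satClosure_initialArcs {S : Set (Zb × Zb)} (hfin : S.Finite) (hS : S ⊆ ArcSet)
    (hsat : Saturated S) : satClosure (initialArcs S) = S := by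
  refine Set.Subset.antisymm (Set.sInter_subset_of_mem ⟨fun p hp => hp.1, hS, hsat⟩) ?_
  rintro ⟨a, b⟩ hab T ⟨hUT, -, hT⟩
  by_cases h : ∃ c, (c, a) ∈ S
  · obtain ⟨c, hca⟩ := h
    obtain ⟨m, hma, hmb⟩ := exists_initialArc_of_mem hfin hS hsat hab hca
    have hma_lt : m < a := hS hma.1
    have hlt : a < b := hS hab
    exact (hT (hUT hma) (hUT hmb) le_rfl hma_lt.le hlt.le).2.2.1 hlt
  · exact hUT ⟨hab, fun c hc => h ⟨c, hc⟩⟩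

theorem initialArcs_nonempty {S : Set (Zb × Zb)} (hfin : S.Finite) (hne : S.Nonempty)
    (hS : S ⊆ ArcSet) (hsat : Saturated S) : (initialArcs S).Nonempty := by
  obtain ⟨⟨a, b⟩, hab⟩ := hne
  by_cases h : ∃ c, (c, a) ∈ S
  · obtain ⟨c, hca⟩ := h
    obtain ⟨m, hma, -⟩ := exists_initialArc_of_mem hfin hS hsat hab hca
    exact ⟨_, hma⟩
  · exact ⟨_, hab, fun c hc => h ⟨c, hc⟩⟩

theorem not_left_lt_of_initialArcs {S : Set (Zb × Zb)} (hsat : Saturated S) {p q : Zb × Zb}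
    (hp : p ∈ initialArcs S) (hq : q ∈ initialArcs S) (hle : q.1 ≤ p.2) (hpq : p.2 ≤ q.2) :
    ¬ p.1 < q.1 :=
  fun hlt => hq.2 p.1 ((hsat hp.1 hq.1 hlt.le hle hpq).1 hlt)

theorem injOn_snd_initialArcs {S : Set (Zb × Zb)} (hS : S ⊆ ArcSet) (hsat : Saturated S) :
    Set.InjOn Prod.snd (initialArcs S) := by
  intro p hp q hq h
  have hp' : p.1 < p.2 := hS hp.1
  have hq' : q.1 < q.2 := hS hq.1
  refine Prod.ext (le_antisymm ?_ ?_) h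
  · exact not_lt.mp (not_left_lt_of_initialArcs hsat hq hp (h ▸ hp'.le) h.ge)
  · exact not_lt.mp (not_left_lt_of_initialArcs hsat hp hq (h ▸ hq'.le) h.le)

/-- Every finite nonempty saturated set of arcs `𝒮` is the saturation of a
sequence of arcs `(l_1,m_1), …, (l_n,m_n) ∈ 𝒮` (`n ≥ 1`) such that for `i < j` none of the
configurations `l_j ≤ l_i < m_j ≤ m_i`, `l_i < l_j ≤ m_i < m_j`, `l_j < l_i ≤ m_j < m_i`
occurs (i.e. the corresponding modules form a strong exceptional collection). -/
theorem stmt8 (S : Set (Zb × Zb)) (hfin : S.Finite) (hne : S.Nonempty)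
    (hS : S ⊆ ArcSet) (hsat : Saturated S) :
    ∃ (n : ℕ) (f : Fin n → Zb × Zb), 1 ≤ n ∧ (∀ i, f i ∈ S) ∧
      satClosure (Set.range f) = S ∧
      ∀ i j : Fin n, i < j →
        ¬((f j).1 ≤ (f i).1 ∧ (f i).1 < (f j).2 ∧ (f j).2 ≤ (f i).2) ∧
        ¬((f i).1 < (f j).1 ∧ (f j).1 ≤ (f i).2 ∧ (f i).2 < (f j).2) ∧
        ¬((f j).1 < (f i).1 ∧ (f i).1 ≤ (f j).2 ∧ (f j).2 < (f i).2) := by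
  have hV : (Prod.snd '' initialArcs S).Finite := (hfin.subset fun p hp => hp.1).image _
  set g := hV.toFinset.orderEmbOfFin rfl
  have hg : ∀ i, ∃ p ∈ initialArcs S, p.2 = g i := fun i =>
    hV.mem_toFinset.mp (hV.toFinset.orderEmbOfFin_mem rfl i)
  choose f hfU hfg using hg
  have hrange : Set.range f = initialArcs S := by
    refine Set.Subset.antisymm (Set.range_subset_iff.mpr hfU) fun p hp => ?_
    have hp2 : p.2 ∈ Set.range g := by
      rw [Finset.range_orderEmbOfFin, hV.coe_toFinset]
      exact ⟨p, hp, rfl⟩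
    obtain ⟨i, hi⟩ := hp2
    exact ⟨i, injOn_snd_initialArcs hS hsat (hfU i) hp ((hfg i).trans hi)⟩
  refine ⟨_, f, ?_, fun i => (hfU i).1, ?_, fun i j hij => ?_⟩
  · rw [Nat.one_le_iff_ne_zero, Finset.card_ne_zero, hV.toFinset_nonempty]
    exact (initialArcs_nonempty hfin hne hS hsat).image _
  · rw [hrange, satClosure_initialArcs hfin hS hsat]
  · have hlt : (f i).2 < (f j).2 := by
      rw [hfg, hfg]
      exact g.strictMono hij
    exact ⟨fun h => hlt.not_ge h.2.2,
      fun h => not_left_lt_of_initialArcs hsat (hfU i) (hfU j) h.2.1 hlt.le h.1,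
      fun h => hlt.not_gt h.2.2⟩
end

section
/- For any non-crossing partition B of 𝒵 = ℤ ∪ {−∞}, the set of arcs α(B) = { (a,b) ∈ 𝒜 : a and b lie in a common block of B } is saturated. Moreover, if {−∞} is a singleton block of B then α(B) ⊆ 𝒜_f. -/
/-- Two blocks of a non-crossing partition containing the endpoints of touching arcs coincide. -/
theorem NonCrossing.block_eq_of_touch {Z : Type*} [PartialOrder Z] {P : Set (Set Z)}
    (hP : Setoid.IsPartition P) (hnc : NonCrossing P) {B₁ B₂ : Set Z} (h₁ : B₁ ∈ P) (h₂ : B₂ ∈ P)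
    {a b c d : Z} (ha : a ∈ B₁) (hb : b ∈ B₁) (hc : c ∈ B₂) (hd : d ∈ B₂)
    (hac : a ≤ c) (hcb : c ≤ b) (hbd : b ≤ d) : B₁ = B₂ := by
  by_contra hne
  have hdisj {x y : Z} (hx : x ∈ B₁) (hy : y ∈ B₂) : x ≠ y := by
    rintro rfl
    exact hne (Setoid.eq_of_mem_eqv_class hP.2 h₁ hx h₂ hy)
  exact (hnc B₁ h₁ B₂ h₂ hne a ha b hb c hc d hd).1
    ⟨hac.lt_of_ne (hdisj ha hc), hcb.lt_of_ne (hdisj hb hc).symm, hbd.lt_of_ne (hdisj hb hd)⟩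

/-- For any non-crossing partition `B` of `𝒵 = ℤ ∪ {−∞}`, the set of arcs
`α(B)` is saturated; moreover if `{−∞}` is a singleton block of `B` then `α(B) ⊆ 𝒜_f`. -/
theorem stmt9 (P : Set (Set Zb)) (hP : Setoid.IsPartition P) (hnc : NonCrossing P) :
    Saturated (alphaMap P) ∧ (({⊥} : Set Zb) ∈ P → alphaMap P ⊆ FinArcSet) := by
  refine ⟨?_, ?_⟩
  · rintro a b c d ⟨-, B₁, h₁, ha, hb⟩ ⟨-, B₂, h₂, hc, hd⟩ hac hcb hbd
    obtain rfl := hnc.block_eq_of_touch hP h₁ h₂ ha hb hc hd hac hcb hbd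
    exact ⟨fun h => ⟨h, B₁, h₁, ha, hc⟩, fun h => ⟨h, B₁, h₁, hc, hb⟩,
      fun h => ⟨h, B₁, h₁, hb, hd⟩, fun h => ⟨h, B₁, h₁, ha, hd⟩⟩
  · rintro hbot ⟨a, b⟩ ⟨hab, B, hB, ha, hb⟩
    refine ⟨bot_lt_iff_ne_bot.2 ?_, hab⟩
    rintro rfl
    obtain rfl := Setoid.eq_of_mem_eqv_class hP.2 hB ha hbot (Set.mem_singleton _)
    exact hab.ne (Set.mem_singleton_iff.1 hb).symm
end

section
/- For any saturated set of arcs 𝒮 ⊆ 𝒜, the collection φ(𝒮) = { φ(𝒮)(a) : a ∈ 𝒵 }, where φ(𝒮)(a) = {a} ∪ { b ∈ 𝒵 : (a,b) ∈ 𝒮 or (b,a) ∈ 𝒮 }, is a non-crossing partition of 𝒵 = ℤ ∪ {−∞}. Moreover, if 𝒮 ⊆ 𝒜_f then {−∞} is a singleton block of φ(𝒮). -/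
theorem mem_phiBlock {S : Set (Zb × Zb)} {a b : Zb} :
    b ∈ phiBlock S a ↔ b = a ∨ (a, b) ∈ S ∨ (b, a) ∈ S := Iff.rfl

theorem mem_phiBlock_self (S : Set (Zb × Zb)) (a : Zb) : a ∈ phiBlock S a := Or.inl rfl

theorem mem_phiBlock_symm {S : Set (Zb × Zb)} {a b : Zb} (h : b ∈ phiBlock S a) :
    a ∈ phiBlock S b := by
  rw [mem_phiBlock] at h ⊢
  tauto

theorem mem_phiBlock_of_mem {S : Set (Zb × Zb)} {a b : Zb} (h : (a, b) ∈ S) :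
    b ∈ phiBlock S a := Or.inr (Or.inl h)

theorem mem_of_mem_phiBlock {S : Set (Zb × Zb)} (hS : S ⊆ ArcSet) {a b : Zb}
    (h : b ∈ phiBlock S a) (hab : a < b) : (a, b) ∈ S := by
  rcases h with h | h | h
  · exact absurd h hab.ne'
  · exact h
  · exact absurd (hS h) hab.asymm

theorem mem_phiBlock_trans {S : Set (Zb × Zb)} (hS : S ⊆ ArcSet) (hsat : Saturated S)
    {a b c : Zb} (hab : b ∈ phiBlock S a) (hbc : c ∈ phiBlock S b) : c ∈ phiBlock S a := by
  have arc_lt : ∀ {x y : Zb}, (x, y) ∈ S → x < y := fun h => hS h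
  rcases hab with rfl | hab | hba
  · exact hbc
  · rcases hbc with rfl | hbc | hcb
    · exact mem_phiBlock_of_mem hab
    · exact mem_phiBlock_of_mem ((hsat hab hbc (arc_lt hab).le le_rfl (arc_lt hbc).le).2.2.2
        ((arc_lt hab).trans (arc_lt hbc)))
    · rcases lt_trichotomy a c with h | rfl | h
      · exact mem_phiBlock_of_mem ((hsat hab hcb h.le (arc_lt hcb).le le_rfl).1 h)
      · exact mem_phiBlock_self S a
      · exact mem_phiBlock_symm (mem_phiBlock_of_mem
          ((hsat hcb hab h.le (arc_lt hab).le le_rfl).1 h))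
  · rcases hbc with rfl | hbc | hcb
    · exact mem_phiBlock_symm (mem_phiBlock_of_mem hba)
    · rcases lt_trichotomy a c with h | rfl | h
      · exact mem_phiBlock_of_mem ((hsat hba hbc le_rfl (arc_lt hba).le h.le).2.2.1 h)
      · exact mem_phiBlock_self S a
      · exact mem_phiBlock_symm (mem_phiBlock_of_mem
          ((hsat hbc hba le_rfl (arc_lt hbc).le h.le).2.2.1 h))
    · exact mem_phiBlock_symm (mem_phiBlock_of_mem
        ((hsat hcb hba (arc_lt hcb).le le_rfl (arc_lt hba).le).2.2.2
          ((arc_lt hcb).trans (arc_lt hba))))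

theorem phiBlock_eq_of_mem {S : Set (Zb × Zb)} (hS : S ⊆ ArcSet) (hsat : Saturated S)
    {a b : Zb} (h : b ∈ phiBlock S a) : phiBlock S a = phiBlock S b :=
  Set.Subset.antisymm (fun _ hx => mem_phiBlock_trans hS hsat (mem_phiBlock_symm h) hx)
    (fun _ hx => mem_phiBlock_trans hS hsat h hx)

/-- Two blocks of `φ(𝒮)` containing crossing pairs coincide. -/
theorem phiBlock_eq_of_crossing {S : Set (Zb × Zb)} (hS : S ⊆ ArcSet) (hsat : Saturated S)
    {x y a b c d : Zb} (ha : a ∈ phiBlock S x) (hb : b ∈ phiBlock S x)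
    (hc : c ∈ phiBlock S y) (hd : d ∈ phiBlock S y) (hac : a < c) (hcb : c < b) (hbd : b < d) :
    phiBlock S x = phiBlock S y := by
  rw [phiBlock_eq_of_mem hS hsat ha] at hb ⊢
  rw [phiBlock_eq_of_mem hS hsat hc] at hd ⊢
  exact phiBlock_eq_of_mem hS hsat (mem_phiBlock_of_mem
    ((hsat (mem_of_mem_phiBlock hS hb (hac.trans hcb))
      (mem_of_mem_phiBlock hS hd (hcb.trans hbd)) hac.le hcb.le hbd.le).1 hac))

theorem phiMap_isPartition {S : Set (Zb × Zb)} (hS : S ⊆ ArcSet) (hsat : Saturated S) :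
    Setoid.IsPartition (phiMap S) := by
  refine ⟨?_, fun a => ⟨phiBlock S a, ⟨⟨a, rfl⟩, mem_phiBlock_self S a⟩, ?_⟩⟩
  · rintro ⟨a, ha⟩
    exact Set.notMem_empty a (ha ▸ mem_phiBlock_self S a)
  · rintro B ⟨⟨x, rfl⟩, hx⟩
    exact phiBlock_eq_of_mem hS hsat hx

theorem phiMap_nonCrossing {S : Set (Zb × Zb)} (hS : S ⊆ ArcSet) (hsat : Saturated S) :
    NonCrossing (phiMap S) := by
  rintro _ ⟨x, rfl⟩ _ ⟨y, rfl⟩ hne a ha b hb c hc d hd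
  exact ⟨fun ⟨h₁, h₂, h₃⟩ => hne (phiBlock_eq_of_crossing hS hsat ha hb hc hd h₁ h₂ h₃),
    fun ⟨h₁, h₂, h₃⟩ => hne (phiBlock_eq_of_crossing hS hsat hc hd ha hb h₁ h₂ h₃).symm⟩

theorem phiBlock_bot {S : Set (Zb × Zb)} (hf : S ⊆ FinArcSet) : phiBlock S ⊥ = {⊥} := by
  refine Set.Subset.antisymm ?_ (Set.singleton_subset_iff.2 (mem_phiBlock_self S ⊥))
  rintro b (h | h | h)
  · exact h
  · exact absurd (hf h).1 (lt_irrefl _)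
  · exact absurd (hf h).2 not_lt_bot

/-- For any saturated set of arcs `𝒮 ⊆ 𝒜`, the collection `φ(𝒮)` of the
blocks `φ(𝒮)(a) = {a} ∪ {b : (a,b) ∈ 𝒮 or (b,a) ∈ 𝒮}` is a non-crossing partition of `𝒵`;
moreover if `𝒮 ⊆ 𝒜_f` then `{−∞}` is a singleton block of `φ(𝒮)`. -/
theorem stmt10 (S : Set (Zb × Zb)) (hS : S ⊆ ArcSet) (hsat : Saturated S) :
    Setoid.IsPartition (phiMap S) ∧ NonCrossing (phiMap S) ∧
    (S ⊆ FinArcSet → phiBlock S ⊥ = {⊥} ∧ ({⊥} : Set Zb) ∈ phiMap S) := by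
  exact ⟨phiMap_isPartition hS hsat, phiMap_nonCrossing hS hsat,
    fun hf => ⟨phiBlock_bot hf, ⊥, (phiBlock_bot hf).symm⟩⟩
end

section
/- For a non-crossing partition B of 𝒵 = ℤ ∪ {−∞}, one has α(B) ⊆ 𝒜_f if and only if {−∞} is a singleton block of B. Consequently α restricts to a bijection between the non-crossing partitions of 𝒵 having {−∞} as a singleton block (equivalently, the non-crossing partitions of ℤ) and the saturated subsets of 𝒜_f. -/
theorem eq_of_mem_of_isPartition {α : Type*} {P : Set (Set α)} (hP : Setoid.IsPartition P)
    {A B : Set α} (hA : A ∈ P) (hB : B ∈ P) {x : α} (hxA : x ∈ A) (hxB : x ∈ B) : A = B :=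
  (hP.2 x).unique ⟨hA, hxA⟩ ⟨hB, hxB⟩

theorem alphaMap_subset_finArcSet_iff {P : Set (Set Zb)} (hP : Setoid.IsPartition P) :
    alphaMap P ⊆ FinArcSet ↔ ({⊥} : Set Zb) ∈ P := by
  constructor
  · intro h
    obtain ⟨B, ⟨hB, hbot⟩, -⟩ := hP.2 ⊥
    have hB' : B = {⊥} := by
      refine Set.eq_singleton_iff_unique_mem.2 ⟨hbot, fun x hx => ?_⟩
      by_contra hne
      have harc : ((⊥, x) : Zb × Zb) ∈ alphaMap P := ⟨bot_lt_iff_ne_bot.2 hne, B, hB, hbot, hx⟩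
      exact lt_irrefl _ (h harc).1
    exact hB' ▸ hB
  · rintro hbot ⟨a, b⟩ ⟨hab, B, hB, ha, hb⟩
    refine ⟨bot_lt_iff_ne_bot.2 ?_, hab⟩
    rintro rfl
    obtain rfl := eq_of_mem_of_isPartition hP hB hbot ha rfl
    exact hab.ne hb.symm

theorem saturated_alphaMap {P : Set (Set Zb)} (hP : Setoid.IsPartition P) (hnc : NonCrossing P) :
    Saturated (alphaMap P) := by
  rintro a b c d ⟨-, A, hA, ha, hb⟩ ⟨-, B, hB, hc, hd⟩ hac hcb hbd
  have hAB : A = B := by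
    by_contra hne
    rcases hac.eq_or_lt with rfl | hac
    · exact hne (eq_of_mem_of_isPartition hP hA hB ha hc)
    rcases hcb.eq_or_lt with rfl | hcb
    · exact hne (eq_of_mem_of_isPartition hP hA hB hb hc)
    rcases hbd.eq_or_lt with rfl | hbd
    · exact hne (eq_of_mem_of_isPartition hP hA hB hb hd)
    exact (hnc A hA B hB hne a ha b hb c hc d hd).1 ⟨hac, hcb, hbd⟩
  subst hAB
  exact ⟨fun h => ⟨h, A, hA, ha, hc⟩, fun h => ⟨h, A, hA, hc, hb⟩,
    fun h => ⟨h, A, hA, hb, hd⟩, fun h => ⟨h, A, hA, ha, hd⟩⟩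

theorem subset_of_alphaMap_subset {P Q : Set (Set Zb)}
    (hQ : Setoid.IsPartition Q) (h : alphaMap P ⊆ alphaMap Q) {A B : Set Zb} (hA : A ∈ P)
    (hB : B ∈ Q) {x : Zb} (hxA : x ∈ A) (hxB : x ∈ B) : A ⊆ B := by
  intro y hy
  rcases lt_trichotomy x y with hxy | rfl | hxy
  · obtain ⟨-, C, hC, hxC, hyC⟩ := h (show (x, y) ∈ alphaMap P from ⟨hxy, A, hA, hxA, hy⟩)
    exact eq_of_mem_of_isPartition hQ hC hB hxC hxB ▸ hyC
  · exact hxB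
  · obtain ⟨-, C, hC, hyC, hxC⟩ := h (show (y, x) ∈ alphaMap P from ⟨hxy, A, hA, hy, hxA⟩)
    exact eq_of_mem_of_isPartition hQ hC hB hxC hxB ▸ hyC

theorem subset_of_alphaMap_eq {P Q : Set (Set Zb)} (hP : Setoid.IsPartition P)
    (hQ : Setoid.IsPartition Q) (h : alphaMap P = alphaMap Q) : P ⊆ Q := by
  intro A hA
  obtain ⟨x, hxA⟩ := Setoid.nonempty_of_mem_partition hP hA
  obtain ⟨B, ⟨hB, hxB⟩, -⟩ := hQ.2 x
  have hAB : A = B := (subset_of_alphaMap_subset hQ h.subset hA hB hxA hxB).antisymm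
    (subset_of_alphaMap_subset hP h.superset hB hA hxB hxA)
  exact hAB ▸ hB

/-- The equivalence relation on `𝒵` determined by a saturated set of arcs. -/
def arcSetoid (S : Set (Zb × Zb)) (hS : S ⊆ ArcSet) (hsat : Saturated S) : Setoid Zb where
  r a b := a = b ∨ (a, b) ∈ S ∨ (b, a) ∈ S
  iseqv :=
    { refl := fun _ => Or.inl rfl
      symm := by
        rintro a b (rfl | h | h)
        exacts [Or.inl rfl, Or.inr (Or.inr h), Or.inr (Or.inl h)]
      trans := by
        rintro a b c (rfl | hab | hba) (rfl | hbc | hcb)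
        · exact Or.inl rfl
        · exact Or.inr (Or.inl hbc)
        · exact Or.inr (Or.inr hcb)
        · exact Or.inr (Or.inl hab)
        · have h₁ : a < b := hS hab
          have h₂ : b < c := hS hbc
          exact Or.inr (Or.inl ((hsat hab hbc h₁.le le_rfl h₂.le).2.2.2 (h₁.trans h₂)))
        · have h₁ : a < b := hS hab
          have h₂ : c < b := hS hcb
          rcases lt_trichotomy a c with h | h | h
          · exact Or.inr (Or.inl ((hsat hab hcb h.le h₂.le le_rfl).1 h))
          · exact Or.inl h
          · exact Or.inr (Or.inr ((hsat hcb hab h.le h₁.le le_rfl).1 h))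
        · exact Or.inr (Or.inr hba)
        · have h₁ : b < a := hS hba
          have h₂ : b < c := hS hbc
          rcases lt_trichotomy a c with h | h | h
          · exact Or.inr (Or.inl ((hsat hba hbc le_rfl h₁.le h.le).2.2.1 h))
          · exact Or.inl h
          · exact Or.inr (Or.inr ((hsat hbc hba le_rfl h₂.le h.le).2.2.1 h))
        · have h₁ : b < a := hS hba
          have h₂ : c < b := hS hcb
          exact Or.inr (Or.inr ((hsat hcb hba h₂.le le_rfl h₁.le).2.2.2 (h₂.trans h₁))) }

theorem mem_of_arcSetoid_of_lt {S : Set (Zb × Zb)} {hS : S ⊆ ArcSet} {hsat : Saturated S}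
    {a b : Zb} (h : arcSetoid S hS hsat a b) (hab : a < b) : (a, b) ∈ S := by
  rcases h with h | h | h
  · exact absurd h hab.ne
  · exact h
  · exact absurd (hS h) hab.not_gt

theorem alphaMap_classes_arcSetoid {S : Set (Zb × Zb)} (hS : S ⊆ ArcSet) (hsat : Saturated S) :
    alphaMap (arcSetoid S hS hsat).classes = S := by
  ext ⟨a, b⟩
  constructor
  · rintro ⟨hab, B, ⟨x, rfl⟩, ha, hb⟩
    exact mem_of_arcSetoid_of_lt (hS := hS) (hsat := hsat)
      (Setoid.trans' _ ha (Setoid.symm' _ hb)) hab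
  · intro h
    exact ⟨hS h, _, Setoid.mem_classes _ b, Or.inr (Or.inl h), Setoid.refl' (arcSetoid S hS hsat) b⟩

theorem nonCrossing_classes_arcSetoid {S : Set (Zb × Zb)} (hS : S ⊆ ArcSet)
    (hsat : Saturated S) : NonCrossing (arcSetoid S hS hsat).classes := by
  have crossing : ∀ {x y a b c d : Zb}, arcSetoid S hS hsat a x → arcSetoid S hS hsat b x →
      arcSetoid S hS hsat c y → arcSetoid S hS hsat d y → a < c → c < b → b < d →
      arcSetoid S hS hsat x y := by
    intro x y a b c d ha hb hc hd hac hcb hbd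
    have hab := mem_of_arcSetoid_of_lt (Setoid.trans' _ ha (Setoid.symm' _ hb)) (hac.trans hcb)
    have hcd := mem_of_arcSetoid_of_lt (Setoid.trans' _ hc (Setoid.symm' _ hd)) (hcb.trans hbd)
    have h : arcSetoid S hS hsat a c :=
      Or.inr (Or.inl ((hsat hab hcd hac.le hcb.le hbd.le).1 hac))
    exact Setoid.trans' _ (Setoid.symm' _ ha) (Setoid.trans' _ h hc)
  rintro _ ⟨x, rfl⟩ _ ⟨y, rfl⟩ hne a ha b hb c hc d hd
  have hxy : ¬ arcSetoid S hS hsat x y := fun h => hne <| Set.ext fun z =>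
    ⟨fun hz => Setoid.trans' _ hz h, fun hz => Setoid.trans' _ hz (Setoid.symm' _ h)⟩
  exact ⟨fun ⟨h₁, h₂, h₃⟩ => hxy (crossing ha hb hc hd h₁ h₂ h₃),
    fun ⟨h₁, h₂, h₃⟩ => hxy (Setoid.symm' _ (crossing hc hd ha hb h₁ h₂ h₃))⟩

/-- For a non-crossing partition `B` of `𝒵`, one has `α(B) ⊆ 𝒜_f` iff
`{−∞}` is a singleton block of `B`; consequently `α` restricts to a bijection between the
non-crossing partitions of `𝒵` having `{−∞}` as a singleton block and the saturated subsets
of `𝒜_f`. -/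
theorem stmt12 :
    (∀ P : Set (Set Zb), Setoid.IsPartition P → NonCrossing P →
      (alphaMap P ⊆ FinArcSet ↔ ({⊥} : Set Zb) ∈ P)) ∧
    Set.BijOn alphaMap
      {P : Set (Set Zb) | Setoid.IsPartition P ∧ NonCrossing P ∧ ({⊥} : Set Zb) ∈ P}
      {S : Set (Zb × Zb) | S ⊆ FinArcSet ∧ Saturated S} := by
  refine ⟨fun P hP _ => alphaMap_subset_finArcSet_iff hP, ?_, ?_, ?_⟩
  · rintro P ⟨hP, hnc, hbot⟩
    exact ⟨(alphaMap_subset_finArcSet_iff hP).2 hbot, saturated_alphaMap hP hnc⟩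
  · rintro P ⟨hP, -⟩ Q ⟨hQ, -⟩ h
    exact (subset_of_alphaMap_eq hP hQ h).antisymm (subset_of_alphaMap_eq hQ hP h.symm)
  · rintro S ⟨hfin, hsat⟩
    have hS : S ⊆ ArcSet := fun p hp => (hfin hp).2
    have hP := Setoid.isPartition_classes (arcSetoid S hS hsat)
    have hα := alphaMap_classes_arcSetoid hS hsat
    exact ⟨_, ⟨hP, nonCrossing_classes_arcSetoid hS hsat,
      (alphaMap_subset_finArcSet_iff hP).1 (hα.subset.trans hfin)⟩, hα⟩
end

section
/- Let t : 𝒜 → 𝒜 be the translation defined by t(a,b) = (a+1, b+1) for a,b ∈ ℤ and t(−∞,b) = (−∞, b+1). If 𝒮 ⊆ 𝒜 is a saturated set of arcs with t(𝒮) = 𝒮, then 𝒮 is one of the following three sets: the empty set ∅, the set 𝒜_f of all finite-length arcs, or the set 𝒜 of all arcs. -/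
/-- The translation `t(a,b) = (a+1,b+1)` on arcs (note `−∞ + 1 = −∞` in `WithBot ℤ`). -/
def trArc (p : Zb × Zb) : Zb × Zb := (p.1 + 1, p.2 + 1)

theorem trArc_injective : Function.Injective trArc := by
  have key : ∀ x y : Zb, x + 1 = y + 1 → x = y := by
    intro x y h
    exact (WithBot.add_right_inj (by exact WithBot.coe_ne_bot (a := (1 : ℤ)))).mp h
  rintro ⟨a, b⟩ ⟨c, d⟩ h
  simp only [trArc, Prod.mk.injEq] at h
  rw [key _ _ h.1, key _ _ h.2]

theorem trArc_mem_iff {S : Set (Zb × Zb)} (ht : trArc '' S = S) (p : Zb × Zb) :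
    trArc p ∈ S ↔ p ∈ S := by
  rw [← trArc_injective.mem_set_image (s := S) (a := p), ht]

/-- Membership of finite arcs in a translation-stable set depends only on the length. -/
theorem coe_mem_iff_zero {S : Set (Zb × Zb)} (ht : trArc '' S = S) (n a : ℤ) :
    (((a : ℤ) : Zb), ((a + n : ℤ) : Zb)) ∈ S ↔ (((0 : ℤ) : Zb), ((0 + n : ℤ) : Zb)) ∈ S := by
  have h : ∀ k : ℤ, (((k + 1 : ℤ) : Zb), ((k + 1 + n : ℤ) : Zb)) ∈ S ↔
      (((k : ℤ) : Zb), ((k + n : ℤ) : Zb)) ∈ S := by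
    intro k
    rw [← trArc_mem_iff ht (((k : ℤ) : Zb), ((k + n : ℤ) : Zb)), add_right_comm]
    rfl
  induction a using Int.induction_on with
  | zero => rfl
  | succ i ih => exact (h _).trans ih
  | pred i ih => exact (h _).symm.trans (by rwa [sub_add_cancel])

/-- A translation-stable set contains all or none of the infinite arcs. -/
theorem bot_mem_iff_zero {S : Set (Zb × Zb)} (ht : trArc '' S = S) (b : ℤ) :
    ((⊥ : Zb), ((b : ℤ) : Zb)) ∈ S ↔ ((⊥ : Zb), ((0 : ℤ) : Zb)) ∈ S := by
  have h : ∀ k : ℤ, ((⊥ : Zb), ((k + 1 : ℤ) : Zb)) ∈ S ↔ ((⊥ : Zb), ((k : ℤ) : Zb)) ∈ S :=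
    fun k => trArc_mem_iff ht ((⊥ : Zb), ((k : ℤ) : Zb))
  induction b using Int.induction_on with
  | zero => rfl
  | succ i ih => exact (h _).trans ih
  | pred i ih => exact (h _).symm.trans (by rwa [sub_add_cancel])

/-- A nonempty saturated translation-stable set of arcs contains an arc of length one. -/
theorem exists_unit_mem {S : Set (Zb × Zb)} (hS : S ⊆ ArcSet) (hsat : Saturated S)
    (ht : trArc '' S = S) {p : Zb × Zb} (hp : p ∈ S) :
    ∃ b : ℤ, (((b : ℤ) : Zb), ((b + 1 : ℤ) : Zb)) ∈ S := by
  obtain ⟨a, b⟩ := p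
  have hab : a < b := hS hp
  have hp' := (trArc_mem_iff ht _).2 hp
  cases b using WithBot.recBotCoe with
  | bot => exact absurd hab not_lt_bot
  | coe b =>
    have hb : (b : Zb) < ((b + 1 : ℤ) : Zb) := WithBot.coe_lt_coe.2 (lt_add_one b)
    refine ⟨b, ?_⟩
    cases a using WithBot.recBotCoe with
    | bot => exact (hsat hp hp' le_rfl bot_le hb.le).2.2.1 hb
    | coe a =>
      have hab' : a < b := WithBot.coe_lt_coe.1 hab
      exact (hsat hp hp' (WithBot.coe_le_coe.2 (by omega : a ≤ a + 1))
        (WithBot.coe_le_coe.2 (by omega : a + 1 ≤ b)) hb.le).2.2.1 hb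

/-- A nonempty saturated translation-stable set of arcs contains every finite arc. -/
theorem finArcSet_subset {S : Set (Zb × Zb)} (hS : S ⊆ ArcSet) (hsat : Saturated S)
    (ht : trArc '' S = S) (hne : S.Nonempty) : FinArcSet ⊆ S := by
  obtain ⟨p, hp⟩ := hne
  obtain ⟨u, hu⟩ := exists_unit_mem hS hsat ht hp
  have unit : ∀ a : ℤ, (((a : ℤ) : Zb), ((a + 1 : ℤ) : Zb)) ∈ S := fun a =>
    (coe_mem_iff_zero ht 1 a).2 ((coe_mem_iff_zero ht 1 u).1 hu)
  have all : ∀ a b : ℤ, a + 1 ≤ b → (((a : ℤ) : Zb), ((b : ℤ) : Zb)) ∈ S := by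
    intro a b hab
    induction b, hab using Int.leInduction with
    | base => exact unit a
    | succ b hab ih =>
      exact (hsat ih (unit b) (WithBot.coe_le_coe.2 (by omega)) le_rfl
        (WithBot.coe_le_coe.2 (by omega))).2.2.2 (WithBot.coe_lt_coe.2 (by omega))
  rintro ⟨a, b⟩ ⟨ha, hab⟩
  cases a using WithBot.recBotCoe with
  | bot => exact absurd ha (lt_irrefl _)
  | coe a =>
    cases b using WithBot.recBotCoe with
    | bot => exact absurd hab not_lt_bot
    | coe b => exact all a b (WithBot.coe_lt_coe.1 hab)

/-- A saturated set of arcs stable under the translation `t` is `∅`,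
`𝒜_f`, or `𝒜`. -/
theorem stmt14 (S : Set (Zb × Zb)) (hS : S ⊆ ArcSet) (hsat : Saturated S)
    (ht : trArc '' S = S) : S = ∅ ∨ S = FinArcSet ∨ S = ArcSet := by
  rcases S.eq_empty_or_nonempty with hne | hne
  · exact Or.inl hne
  have hfin := finArcSet_subset hS hsat ht hne
  by_cases h0 : ((⊥ : Zb), ((0 : ℤ) : Zb)) ∈ S
  · refine Or.inr (Or.inr (hS.antisymm ?_))
    rintro ⟨a, b⟩ hab
    change a < b at hab
    cases a using WithBot.recBotCoe with
    | coe a => exact hfin ⟨WithBot.bot_lt_coe a, hab⟩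
    | bot =>
      cases b using WithBot.recBotCoe with
      | bot => exact absurd hab not_lt_bot
      | coe b => exact (bot_mem_iff_zero ht b).2 h0
  · refine Or.inr (Or.inl (Set.Subset.antisymm ?_ hfin))
    rintro ⟨a, b⟩ hp
    have hab : a < b := hS hp
    cases a using WithBot.recBotCoe with
    | coe a => exact ⟨WithBot.bot_lt_coe a, hab⟩
    | bot =>
      cases b using WithBot.recBotCoe with
      | bot => exact absurd hab not_lt_bot
      | coe b => exact absurd ((bot_mem_iff_zero ht b).1 hp) h0
end

section
/- Let 𝒞 be a Grothendieck abelian category in which every injective object is isomorphic to a coproduct of indecomposable objects. Then every coproduct of injective objects of 𝒞 is injective. -/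
open CategoryTheory CategoryTheory.Limits

universe w w' v u

variable {C : Type u} [Category.{v} C] [Abelian C]

/-- Two morphisms into `E` are disjoint if only zero factors compatibly through both; for
monomorphisms, the corresponding subobjects meet in zero. -/
def IsDisjointPair {E K L : C} (k : K ⟶ E) (l : L ⟶ E) : Prop :=
  ∀ ⦃X : C⦄ (a : X ⟶ K) (b : X ⟶ L), a ≫ k = b ≫ l → a = 0

lemma IsDisjointPair.symm {E K L : C} {k : K ⟶ E} {l : L ⟶ E} [Mono l]
    (h : IsDisjointPair k l) : IsDisjointPair l k := fun X a b hab => by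
  have hb := h b a hab.symm
  rw [← cancel_mono l, hab, hb, zero_comp, zero_comp]

lemma isDisjointPair_iff_mono {E K L : C} {k : K ⟶ E} {l : L ⟶ E} [Mono l] :
    IsDisjointPair k l ↔ Mono (k ≫ cokernel.π l) := by
  refine ⟨fun h => Preadditive.mono_of_cancel_zero _ fun a ha => ?_, fun h X a b hab => ?_⟩
  · have := (Abelian.monoLift_comp l (a ≫ k) (by simpa using ha))
    exact h a _ this.symm
  · rw [← cancel_mono (k ≫ cokernel.π l), ← Category.assoc, hab]
    simp

lemma exists_isDisjointPair_upperBound [IsGrothendieckAbelian.{v} C] {E : C} {S : Type v}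
    [Preorder S] [IsDirectedOrder S] [Nonempty S] {f : S → Subobject E} (hf : Monotone f) {K : C} (k : K ⟶ E)
    (h : ∀ s, IsDisjointPair k (f s).arrow) :
    ∃ L : Subobject E, (∀ s, f s ≤ L) ∧ IsDisjointPair k L.arrow := by
  let D : S ⥤ C :=
    { obj s := cokernel (f s).arrow
      map {s t} g := cokernel.desc _ (cokernel.π _) (by
        rw [← Subobject.ofLE_arrow (hf (leOfHom g)), Category.assoc, cokernel.condition, comp_zero]) }
  let α : (Functor.const S).obj K ⟶ D := { app s := k ≫ cokernel.π (f s).arrow }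
  have hα (s : S) : Mono (α.app s) := isDisjointPair_iff_mono.1 (h s)
  have := NatTrans.mono_of_mono_app α
  let s₀ : S := Classical.arbitrary S
  let q : E ⟶ colimit D := cokernel.π (f s₀).arrow ≫ colimit.ι D s₀
  have hq (s : S) : cokernel.π (f s).arrow ≫ colimit.ι D s = q := by
    obtain ⟨t, hs, ht⟩ := exists_ge_ge s s₀
    have h1 := colimit.w D (homOfLE hs)
    have h2 := colimit.w D (homOfLE ht)
    simp only [q]
    rw [← h1, ← h2]
    simp [D]
  have := IsFiltered.isConnected S
  have hm : Mono (k ≫ q) := colim.map_mono' α (isColimitConstCocone S K)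
    (colimit.isColimit D) (k ≫ q) (fun s => by simp [α, hq]; exact Category.id_comp _)
  refine ⟨kernelSubobject q, fun s => ?_, fun X a b hab => ?_⟩
  · exact le_kernelSubobject _ _ (by rw [← hq s]; simp)
  · rw [← cancel_mono (k ≫ q), ← Category.assoc, hab]
    simp

lemma exists_maximal_disjoint [IsGrothendieckAbelian.{v} C] {E : C} {K : C} (k : K ⟶ E)
    (L₀ : Subobject E) (h : IsDisjointPair k L₀.arrow) :
    ∃ L : Subobject E, L₀ ≤ L ∧ Maximal (fun L => IsDisjointPair k L.arrow) L := by
  refine zorn_le_nonempty₀ {L : Subobject E | IsDisjointPair k L.arrow} (fun c hc hch y hy => ?_)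
    L₀ h
  have : Small.{v} c := inferInstance
  let _ : Preorder (Shrink.{v} c) := Preorder.lift (fun s => ((equivShrink c).symm s : Subobject E))
  have : Nonempty (Shrink.{v} c) := ⟨equivShrink c ⟨y, hy⟩⟩
  have : IsDirectedOrder (Shrink.{v} c) := ⟨fun s t => by
    rcases hch.total ((equivShrink c).symm s).2 ((equivShrink c).symm t).2 with h | h
    · exact ⟨t, h, le_refl _⟩
    · exact ⟨s, le_refl _, h⟩⟩
  obtain ⟨L, hL, hL'⟩ := exists_isDisjointPair_upperBound (S := Shrink.{v} c)
    (f := fun s => ((equivShrink c).symm s : Subobject E)) (fun s t h => h) k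
    (fun s => hc ((equivShrink c).symm s).2)
  exact ⟨L, hL', fun z hz => by simpa using hL (equivShrink c ⟨z, hz⟩)⟩

lemma isIso_of_indecomposable {A E : C} (hE : Indecomposable E) (i : A ⟶ E) [IsSplitMono i]
    (hA : ¬ IsZero A) : IsIso i := by
  have e : E ≅ A ⊞ cokernel i :=
    (ShortComplex.Splitting.ofExactOfRetraction
      (ShortComplex.mk i (cokernel.π i) (by simp)) (ShortComplex.exact_cokernel i) (retraction i)
      (by simp) inferInstance).isoBinaryBiproduct
  have hz := (hE.2 _ _ e).resolve_left hA
  have : Epi i := Preadditive.epi_of_isZero_cokernel _ hz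
  exact isIso_of_mono_of_epi i

/-- An object is uniform if any two of its nonzero subobjects meet nontrivially. -/
def IsUniformObject (E : C) : Prop :=
  ∀ ⦃K L : C⦄ (k : K ⟶ E) (l : L ⟶ E) [Mono k] [Mono l], IsDisjointPair k l →
    IsZero K ∨ IsZero L

/-- The image of `M` in the quotient by a maximal subobject disjoint from it is essential. -/
lemma mono_of_maximal {E M : C} (m : M ⟶ E) (L : Subobject E)
    (hL : Maximal (fun L => IsDisjointPair m L.arrow) L) {T : C} (g : cokernel L.arrow ⟶ T)
    [Mono (m ≫ cokernel.π L.arrow ≫ g)] : Mono g := by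
  let q := cokernel.π L.arrow ≫ g
  have h1 : IsDisjointPair m (kernelSubobject q).arrow := fun X a b hab => by
    rw [← cancel_mono (m ≫ cokernel.π L.arrow ≫ g), ← Category.assoc, hab]
    change (b ≫ _) ≫ q = _
    simp
  have h2 : L ≤ kernelSubobject q := le_kernelSubobject _ _ (by simp [q])
  refine Preadditive.mono_of_cancel_zero _ fun {X} a ha => ?_
  let p := pullback.fst a (cokernel.π L.arrow)
  let r := pullback.snd a (cokernel.π L.arrow)
  have hpr : p ≫ a = r ≫ cokernel.π L.arrow := pullback.condition
  have hr : L.Factors r := Subobject.factors_of_le r (hL.2 h1 h2)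
    (kernelSubobject_factors _ _ (by simp [q, r, p, ← reassoc_of% hpr, ha]))
  rw [← cancel_epi p, hpr, ← L.factorThru_arrow r hr]
  simp [-Subobject.factorThru_arrow]

/-- An indecomposable injective object of a Grothendieck category is uniform. -/
lemma isUniformObject [IsGrothendieckAbelian.{v} C] {E : C} [Injective E]
    (hE : Indecomposable E) : IsUniformObject E := by
  intro K L k l _ _ hkl
  by_cases hK : IsZero K
  · exact Or.inl hK
  right
  have h0 : IsDisjointPair l (Subobject.mk k).arrow := fun X a b hab =>
    hkl.symm a (b ≫ (Subobject.underlyingIso k).hom) (by simpa using hab)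
  obtain ⟨M, hKM, hM⟩ := exists_maximal_disjoint l _ h0
  have h1 : IsDisjointPair M.arrow (Subobject.mk l).arrow := fun X a b hab =>
    hM.1.symm a (b ≫ (Subobject.underlyingIso l).hom) (by simpa using hab)
  obtain ⟨N, hLN, hN⟩ := exists_maximal_disjoint M.arrow _ h1
  let m := M.arrow ≫ cokernel.π N.arrow
  have hm : Mono m := isDisjointPair_iff_mono.1 hN.1
  let g : cokernel N.arrow ⟶ E := Injective.factorThru M.arrow m
  have hg : m ≫ g = M.arrow := Injective.comp_factorThru _ _
  have hg' : M.arrow ≫ cokernel.π N.arrow ≫ g = M.arrow := by simpa [m] using hg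
  have : Mono (M.arrow ≫ cokernel.π N.arrow ≫ g) := by rw [hg']; infer_instance
  have hgm : Mono g := mono_of_maximal M.arrow N hN g
  have : Mono (M.arrow ≫ cokernel.π N.arrow ≫ g ≫ cokernel.π N.arrow) := by
    rw [reassoc_of% hg']; exact hm
  have h2 : Mono (g ≫ cokernel.π N.arrow) := mono_of_maximal M.arrow N hN _
  have h3 : IsDisjointPair l (Subobject.mk g).arrow := by
    have h4 : IsDisjointPair N.arrow g := (isDisjointPair_iff_mono.2 h2).symm
    intro X a b hab
    have := h4 (a ≫ (Subobject.underlyingIso l).inv ≫ Subobject.ofLE _ _ hLN)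
      (b ≫ (Subobject.underlyingIso g).hom) (by simpa using hab)
    rw [← cancel_mono ((Subobject.underlyingIso l).inv ≫ Subobject.ofLE _ _ hLN), this, zero_comp]
  have h4 : M ≤ Subobject.mk g := Subobject.le_mk_of_comm m hg
  have h5 : Subobject.mk g ≤ M := hM.2 h3 h4
  let t : cokernel N.arrow ⟶ (M : C) :=
    (Subobject.underlyingIso g).inv ≫ Subobject.ofLE _ _ h5
  have ht : t ≫ M.arrow = g := by simp [t]
  have : IsSplitMono M.arrow := ⟨⟨cokernel.π N.arrow ≫ t, by
    rw [← cancel_mono M.arrow]; simp [ht, hg']⟩⟩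
  have hMz : ¬ IsZero (M : C) := fun hz => hK <| by
    exact IsZero.of_mono ((Subobject.underlyingIso k).inv ≫ Subobject.ofLE _ _ hKM) hz
  have := isIso_of_indecomposable hE M.arrow hMz
  rw [IsZero.iff_id_eq_zero]
  exact hM.1 (𝟙 L) (l ≫ inv M.arrow) (by simp)


lemma IsUniformObject.not_isZero_pullback {E K L : C} (hE : IsUniformObject E) (k : K ⟶ E)
    (l : L ⟶ E) [Mono k] [Mono l] (hK : ¬ IsZero K) (hL : ¬ IsZero L) :
    ¬ IsZero (pullback k l) := fun hz => by
  refine (hE k l fun X a b hab => ?_).elim hK hL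
  rw [← pullback.lift_fst a b hab, hz.eq_of_tgt (pullback.lift a b hab) 0, zero_comp]

lemma not_isZero_kernel {K F : C} (f : K ⟶ F) (hf : ¬ Mono f) : ¬ IsZero (kernel f) :=
  fun hz => hf (Preadditive.mono_of_isZero_kernel f hz)

/-- The morphism `⨁ i ∈ S, K i ⟶ ⨁ j ∈ A, F j` with entries `f i j` is a monomorphism, expressed
through generalized elements. -/
def IsIndepMatrix {I J : Type*} {K : I → C} {F : J → C} (S : Finset I) (A : Finset J)
    (f : ∀ i j, K i ⟶ F j) : Prop :=
  ∀ ⦃X : C⦄ (x : ∀ i, X ⟶ K i), (∀ j ∈ A, ∑ i ∈ S, x i ≫ f i j = 0) → ∀ i ∈ S, x i = 0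

/-- Finite Goldie dimension: `n` nonzero objects cannot be independent inside a coproduct of fewer
than `n` uniform objects. -/
lemma IsIndepMatrix.card_le {I J : Type*} {F : J → C} (hF : ∀ j, IsUniformObject (F j))
    (A : Finset J) : ∀ {K : I → C} (S : Finset I) (f : ∀ i j, K i ⟶ F j)
    (_ : ∀ i ∈ S, ¬ IsZero (K i)) (_ : IsIndepMatrix S A f), S.card ≤ A.card := by
  classical
  induction A using Finset.induction_on with
  | empty =>
    intro K S f hK h
    rcases S.eq_empty_or_nonempty with rfl | ⟨i, hi⟩
    · simp
    · refine absurd ?_ (hK i hi)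
      have := h (X := K i) (Pi.single i (𝟙 _)) (by simp) i hi
      rw [IsZero.iff_id_eq_zero]
      simpa using this
  | insert j A hj ih =>
    intro K S f hK h
    rw [Finset.card_insert_of_notMem hj]
    by_cases hm : ∃ i ∈ S, Mono (f i j)
    · obtain ⟨i₀, hi₀, hm⟩ := hm
      have hc := ih (K := fun i => pullback (f i j) (f i₀ j)) (S.erase i₀)
        (fun i j' => pullback.fst _ _ ≫ f i j' - pullback.snd _ _ ≫ f i₀ j') ?_ ?_
      · have := Finset.card_erase_add_one hi₀
        lia
      · intro i hi hz
        have hi' := hK i (Finset.mem_of_mem_erase hi)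
        by_cases hmi : Mono (f i j)
        · exact (hF j).not_isZero_pullback _ _ hi' (hK i₀ hi₀) hz
        · have hw : kernel.ι (f i j) ≫ f i j = (0 : _ ⟶ K i₀) ≫ f i₀ j := by simp
          have := mono_of_mono_fac (pullback.lift_fst _ _ hw)
          exact not_isZero_kernel _ hmi (IsZero.of_mono (pullback.lift _ _ hw) hz)
      · intro X x hx i hi
        let y : ∀ i, X ⟶ K i := Function.update (fun i => x i ≫ pullback.fst _ _) i₀
          (- ∑ i ∈ S.erase i₀, x i ≫ pullback.snd (f i j) (f i₀ j))
        have hy₀ : y i₀ = - ∑ i ∈ S.erase i₀, x i ≫ pullback.snd (f i j) (f i₀ j) := by simp [y]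
        have hy (i) (hi : i ∈ S.erase i₀) : y i = x i ≫ pullback.fst _ _ := by
          simp [y, Finset.ne_of_mem_erase hi]
        have hsum (j') : ∑ i ∈ S, y i ≫ f i j' = ∑ i ∈ S.erase i₀,
            x i ≫ (pullback.fst (f i j) (f i₀ j) ≫ f i j' - pullback.snd _ _ ≫ f i₀ j') := by
          rw [← Finset.sum_erase_add _ _ hi₀, hy₀,
            Finset.sum_congr rfl (fun i hi => by rw [hy i hi])]
          simp [Preadditive.sum_comp, sub_eq_add_neg, Finset.sum_add_distrib]
        have := h y (fun j' hj' => ?_) i (Finset.mem_of_mem_erase hi)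
        · rw [hy i hi] at this
          rwa [← cancel_mono (pullback.fst (f i j) (f i₀ j)), zero_comp]
        · rw [hsum]
          rcases Finset.mem_insert.1 hj' with rfl | hj'
          · exact Finset.sum_eq_zero fun i _ => by rw [pullback.condition, sub_self, comp_zero]
          · exact hx j' hj'
    · push Not at hm
      have hc := ih (K := fun i => kernel (f i j)) S (fun i j' => kernel.ι (f i j) ≫ f i j')
        (fun i hi => not_isZero_kernel _ (hm i hi)) ?_
      · lia
      · intro X x hx i hi
        have := h (fun i => x i ≫ kernel.ι (f i j)) (fun j' hj' => ?_) i hi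
        · rwa [← cancel_mono (kernel.ι (f i j)), zero_comp]
        · rcases Finset.mem_insert.1 hj' with rfl | hj'
          · simp
          · simpa using hx j' hj'

lemma exists_subobject_annihilated {E : C} (hE : IsUniformObject E) {J : Type*} {F : J → C}
    (f : ∀ j, E ⟶ F j) {K : C} (k : K ⟶ E) [Mono k] (hK : ¬ IsZero K) (Q : Finset J)
    (hQ : ∀ j ∈ Q, ¬ Mono (f j)) :
    ∃ (K' : C) (k' : K' ⟶ K), Mono k' ∧ ¬ IsZero K' ∧ ∀ j ∈ Q, k' ≫ k ≫ f j = 0 := by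
  classical
  induction Q using Finset.induction_on with
  | empty => exact ⟨K, 𝟙 K, inferInstance, hK, by simp⟩
  | insert j Q _ ih =>
    obtain ⟨L, l, _, hL, hl⟩ := ih fun j hj => hQ j (Finset.mem_insert_of_mem hj)
    refine ⟨pullback (l ≫ k) (kernel.ι (f j)), pullback.fst _ _ ≫ l, inferInstance,
      hE.not_isZero_pullback _ _ hL (not_isZero_kernel _ (hQ j (Finset.mem_insert_self _ _))), ?_⟩
    intro j' hj'
    rcases Finset.mem_insert.1 hj' with rfl | hj'
    · have := pullback.condition (f := l ≫ k) (g := kernel.ι (f j')) =≫ f j'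
      simpa using this
    · simp [hl j' hj']

section FiniteSupport

variable [IsGrothendieckAbelian.{v} C]

/-- Projection onto the summands indexed by `P`. -/
noncomputable def sigmaProj {J : Type v} [DecidableEq J] (F : J → C) (P : Finset J) : ∐ F ⟶ ∐ F :=
  ∑ j ∈ P, Sigma.π F j ≫ Sigma.ι F j

lemma ι_sigmaProj_of_mem {J : Type v} [DecidableEq J] (F : J → C) {P : Finset J} {j : J}
    (hj : j ∈ P) :
    Sigma.ι F j ≫ sigmaProj F P = Sigma.ι F j := by
  classical
  rw [sigmaProj, Preadditive.comp_sum, Finset.sum_eq_single_of_mem j hj]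
  · simp
  · intro i _ hij
    simp [Sigma.ι_π_of_ne_assoc F hij.symm]

lemma sigmaProj_comp_of_subset {J : Type v} [DecidableEq J] (F : J → C) {P Q : Finset J}
    (h : P ⊆ Q) :
    sigmaProj F P ≫ sigmaProj F Q = sigmaProj F P := by
  rw [sigmaProj, Preadditive.sum_comp]
  exact Finset.sum_congr rfl fun j hj => by rw [Category.assoc, ι_sigmaProj_of_mem F (h hj)]

/-- Any morphism from a nonzero object to a coproduct has, on some nonzero subobject, values in a
finite subcoproduct. -/
lemma exists_finite_support {J : Type v} [DecidableEq J] (F : J → C) {X : C}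
    (a : X ⟶ ∐ F) (hX : ¬ IsZero X) :
    ∃ (P : Finset J) (K : C) (k : K ⟶ X), Mono k ∧ ¬ IsZero K ∧
      k ≫ a ≫ sigmaProj F P = k ≫ a := by
  classical
  by_cases hP : ∃ P : Finset J, ¬ Mono (a ≫ cokernel.π (sigmaProj F P))
  · obtain ⟨P, hP⟩ := hP
    refine ⟨P, _, kernel.ι (a ≫ cokernel.π (sigmaProj F P)), inferInstance,
      not_isZero_kernel _ hP, ?_⟩
    have h1 : sigmaProj F P ≫ (𝟙 _ - sigmaProj F P) = 0 := by
      simp [sigmaProj_comp_of_subset F (le_refl P)]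
    have h2 := kernel.condition (a ≫ cokernel.π (sigmaProj F P)) =≫ cokernel.desc _ _ h1
    simp only [Category.assoc, cokernel.π_desc, Preadditive.comp_sub, zero_comp,
      Category.comp_id] at h2
    exact (sub_eq_zero.1 h2).symm
  · push Not at hP
    exfalso
    let D : Finset J ⥤ C :=
      { obj P := cokernel (sigmaProj F P)
        map {P Q} g := cokernel.desc _ (cokernel.π _) (by
          rw [← sigmaProj_comp_of_subset F (leOfHom g), Category.assoc, cokernel.condition,
            comp_zero]) }
    let α : (Functor.const (Finset J)).obj X ⟶ D :=
      { app P := a ≫ cokernel.π (sigmaProj F P) }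
    have hα (P) : Mono (α.app P) := hP P
    have := NatTrans.mono_of_mono_app α
    have hz : IsZero (colimit D) := by
      rw [IsZero.iff_id_eq_zero]
      refine colimit.hom_ext fun P => ?_
      simp only [Category.comp_id, comp_zero]
      rw [← cancel_epi (cokernel.π (sigmaProj F P))]
      refine Sigma.hom_ext _ _ fun j => ?_
      rw [← colimit.w D (homOfLE (Finset.subset_insert j P))]
      simp only [D, cokernel.π_desc_assoc, comp_zero]
      rw [← ι_sigmaProj_of_mem F (Finset.mem_insert_self j P)]
      simp
    have := IsFiltered.isConnected (Finset J)
    have hm : Mono (0 : X ⟶ colimit D) := colim.map_mono' α (isColimitConstCocone _ X)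
      (colimit.isColimit D) 0 (fun s => hz.eq_of_tgt _ _)
    exact hX (IsZero.of_mono 0 hz)

/-- If a coproduct of uniform objects `E i` embeds in a coproduct of uniform objects `F j`, then by
Hall's marriage theorem the `E i` embed in pairwise distinct `F j`. -/
lemma exists_injective_mono {I J : Type v} [DecidableEq J] {E : I → C} {F : J → C}
    (hE₀ : ∀ i, ¬ IsZero (E i)) (hE : ∀ i, IsUniformObject (E i))
    (hF : ∀ j, IsUniformObject (F j)) (m : ∐ E ⟶ ∐ F) [Mono m] :
    ∃ φ : I → J, Function.Injective φ ∧ ∀ i, Mono (Sigma.ι E i ≫ m ≫ Sigma.π F (φ i)) := by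
  classical
  have key (i : I) : ∃ (A : Finset J) (K : C) (k : K ⟶ E i), Mono k ∧ ¬ IsZero K ∧
      (∀ j ∈ A, Mono (Sigma.ι E i ≫ m ≫ Sigma.π F j)) ∧
      k ≫ Sigma.ι E i ≫ m ≫ sigmaProj F A = k ≫ Sigma.ι E i ≫ m := by
    obtain ⟨P, K, k, _, hK, hk⟩ := exists_finite_support F (Sigma.ι E i ≫ m) (hE₀ i)
    let f (j : J) : E i ⟶ F j := Sigma.ι E i ≫ m ≫ Sigma.π F j
    obtain ⟨K', k', _, hK', hk'⟩ := exists_subobject_annihilated (hE i) f k hK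
      (P.filter fun j => ¬ Mono (f j)) (by simp)
    refine ⟨P.filter fun j => Mono (f j), K', k' ≫ k, inferInstance, hK', by simp [f], ?_⟩
    have h1 : sigmaProj F P = sigmaProj F (P.filter fun j => Mono (f j)) +
        sigmaProj F (P.filter fun j => ¬ Mono (f j)) :=
      (Finset.sum_filter_add_sum_filter_not _ _ _).symm
    have h2 : k' ≫ k ≫ Sigma.ι E i ≫ m ≫ sigmaProj F (P.filter fun j => ¬ Mono (f j)) = 0 := by
      simp only [sigmaProj, Preadditive.comp_sum]
      refine Finset.sum_eq_zero fun j hj => ?_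
      have := hk' j hj =≫ Sigma.ι F j
      simpa [f] using this
    have h3 := k' ≫= hk
    simp only [h1, Preadditive.comp_add, Category.assoc, h2, add_zero] at h3
    simpa using h3
  choose A K k hkm hK hA hk using key
  have hall : ∀ S : Finset I, S.card ≤ (S.biUnion A).card := fun S => by
    refine IsIndepMatrix.card_le (K := K) hF (S.biUnion A) S
      (fun i j => k i ≫ Sigma.ι E i ≫ m ≫ Sigma.π F j) (fun i _ => hK i) fun X x hx i hi => ?_
    let y : X ⟶ ∐ E := ∑ i ∈ S, x i ≫ k i ≫ Sigma.ι E i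
    have h1 : y ≫ m ≫ sigmaProj F (S.biUnion A) = y ≫ m := by
      simp only [y, Preadditive.sum_comp, Category.assoc]
      refine Finset.sum_congr rfl fun i hi => ?_
      have := (k i ≫ Sigma.ι E i ≫ m) ≫= sigmaProj_comp_of_subset F
        (Finset.subset_biUnion_of_mem A hi)
      rw [← hk i]
      simp only [Category.assoc] at this
      have h' := hk i =≫ sigmaProj F (S.biUnion A)
      simp only [Category.assoc] at h'
      rw [← h', this]
    have h2 : y ≫ m ≫ sigmaProj F (S.biUnion A) = 0 := by
      simp only [sigmaProj, Preadditive.comp_sum]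
      refine Finset.sum_eq_zero fun j hj => ?_
      have := hx j hj =≫ Sigma.ι F j
      simpa [y, Preadditive.sum_comp] using this
    have hy : y = 0 := by rw [← cancel_mono m, ← h1, h2, zero_comp]
    have h3 : y ≫ Sigma.π E i = x i ≫ k i := by
      simp only [y, Preadditive.sum_comp, Category.assoc]
      rw [Finset.sum_eq_single_of_mem i hi]
      · simp
      · intro i' _ hne
        simp [Sigma.ι_π_of_ne E hne]
    rw [← cancel_mono (k i), ← h3, hy, zero_comp, zero_comp]
  obtain ⟨φ, hφ, hφA⟩ := (Finset.all_card_le_biUnion_card_iff_exists_injective A).1 hall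
  exact ⟨φ, hφ, fun i => hA i _ (hφA i)⟩

end FiniteSupport

/-- A family of nonzero direct summands of an object, with orthogonal projections, is small. -/
lemma small_of_biorthogonal {T : Type*} {F : T → C} {X : C} (i : ∀ t, F t ⟶ X)
    (p : ∀ t, X ⟶ F t) (hid : ∀ t, i t ≫ p t = 𝟙 _) (hne : ∀ t t', t ≠ t' → i t ≫ p t' = 0)
    (hF : ∀ t, ¬ IsZero (F t)) : Small.{v} T := by
  refine small_of_injective (β := X ⟶ X) (f := fun t => p t ≫ i t) fun t t' h => ?_
  by_contra htt
  refine hF t ((IsZero.iff_id_eq_zero _).2 ?_)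
  have := i t ≫= h =≫ p t
  simpa [hid, reassoc_of% hne t t' htt] using this

lemma exists_small_iso_sigma {ι : Type*} (f : ι → C) [HasCoproduct f] [HasCoproducts.{v} C]
    (hf : ∀ i, ¬ IsZero (f i)) :
    ∃ (T : Type v) (e : T ≃ ι), Nonempty (∐ f ≅ ∐ (f ∘ e)) := by
  classical
  have : Small.{v} ι := small_of_biorthogonal (Sigma.ι f) (Sigma.π f) (by simp)
    (fun t t' h => Sigma.ι_π_of_ne f h) hf
  exact ⟨_, (equivShrink ι).symm, ⟨(Sigma.reindex (equivShrink ι).symm f).symm⟩⟩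

lemma isIso_of_mono_of_injective {A E : C} [Injective A] (hA : ¬ IsZero A)
    (hE : Indecomposable E) (f : A ⟶ E) [Mono f] : IsIso f :=
  have : IsSplitMono f := ⟨⟨Injective.factorThru (𝟙 A) f, Injective.comp_factorThru _ _⟩⟩
  isIso_of_indecomposable hE f hA

lemma Injective.of_sigma {ι : Type*} (f : ι → C) [HasCoproduct f] [Injective (∐ f)] (i : ι) :
    Injective (f i) := by
  classical
  exact Retract.injective (Y := ∐ f) ⟨Sigma.ι f i, Sigma.π f i, by simp⟩

/-- A sub-coproduct is a retract. -/
noncomputable def retractSigmaComp {I J : Type*} (F : J → C) {φ : I → J}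
    (hφ : Function.Injective φ) [HasCoproduct F] [HasCoproduct (fun i => F (φ i))] :
    Retract (∐ fun i => F (φ i)) (∐ F) := by
  classical
  exact
  { i := Sigma.desc fun i => Sigma.ι F (φ i)
    r := Sigma.desc fun j => if h : ∃ i, φ i = j then
      eqToHom (by rw [h.choose_spec]) ≫ Sigma.ι (fun i => F (φ i)) h.choose else 0
    retract := by
      refine Sigma.hom_ext _ _ fun i => ?_
      have h : ∃ i', φ i' = φ i := ⟨i, rfl⟩
      simp only [Sigma.ι_desc_assoc, Sigma.ι_desc, Category.comp_id, dif_pos h]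
      exact Sigma.eqToHom_comp_ι (fun i => F (φ i)) (hφ h.choose_spec.symm) }

theorem injective_sigma_of_indecomposable [IsGrothendieckAbelian.{v} C]
    (h : ∀ J : C, Injective J → ∃ (ι : Type v) (f : ι → C),
      (∀ i, Indecomposable (f i)) ∧ Nonempty (J ≅ ∐ f))
    {I : Type v} (E : I → C) (hE : ∀ i, Indecomposable (E i)) [∀ i, Injective (E i)] :
    Injective (∐ E) := by
  classical
  obtain ⟨J, F, hF, ⟨e⟩⟩ := h (Injective.under (∐ E)) inferInstance
  have : Injective (∐ F) := Injective.of_iso e inferInstance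
  have hFi (j : J) : Injective (F j) := Injective.of_sigma F j
  obtain ⟨φ, hφ, hm⟩ := exists_injective_mono (fun i => (hE i).1)
    (fun i => isUniformObject (hE i)) (fun j => isUniformObject (hF j))
    (Injective.ι (∐ E) ≫ e.hom)
  have hi (i : I) := isIso_of_mono_of_injective (hE i).1 (hF (φ i))
    (Sigma.ι E i ≫ (Injective.ι (∐ E) ≫ e.hom) ≫ Sigma.π F (φ i))
  have : Injective (∐ fun i => F (φ i)) := (retractSigmaComp F hφ).injective
  exact Injective.of_iso (Sigma.mapIso fun i => (asIso (Sigma.ι E i ≫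
    (Injective.ι (∐ E) ≫ e.hom) ≫ Sigma.π F (φ i))).symm) this

/-- Let `C` be a Grothendieck abelian category (abelian, cocomplete, AB5,
with a separator) in which every injective object is isomorphic to a coproduct of
indecomposable objects. Then every coproduct of injective objects of `C` is injective. -/
theorem stmt16 {C : Type u} [Category.{v} C] [Abelian C] [HasColimits C] [AB5 C]
    (G : C) (hG : IsSeparator G)
    (h : ∀ J : C, Injective J → ∃ (ι : Type w) (f : ι → C) (_ : HasCoproduct f),
      (∀ i, Indecomposable (f i)) ∧ Nonempty (J ≅ ∐ f))
    (ι' : Type w') (g : ι' → C) [HasCoproduct g] (hg : ∀ i, Injective (g i)) :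
    Injective (∐ g) := by
  classical
  have : HasSeparator C := ⟨G, hG⟩
  have : IsGrothendieckAbelian.{v} C := { }
  have h' (J : C) (hJ : Injective J) : ∃ (ι : Type v) (f : ι → C),
      (∀ i, Indecomposable (f i)) ∧ Nonempty (J ≅ ∐ f) := by
    obtain ⟨ι, f, _, hf, ⟨e⟩⟩ := h J hJ
    obtain ⟨T, ε, ⟨e'⟩⟩ := exists_small_iso_sigma f fun i => (hf i).1
    exact ⟨T, f ∘ ε, fun t => hf _, ⟨e ≪≫ e'⟩⟩
  choose T E hE e using fun i => h' (g i) (hg i)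
  replace e i := (e i).some
  have hinj (i : ι') (t : T i) : Injective (E i t) :=
    have : Injective (∐ E i) := Injective.of_iso (e i) (hg i)
    Injective.of_sigma (E i) t
  let F (p : Σ i, T i) : C := E p.1 p.2
  have : Small.{v} (Σ i, T i) := by
    refine small_of_biorthogonal (F := F) (X := ∐ g)
      (fun p => Sigma.ι (E p.1) p.2 ≫ (e p.1).inv ≫ Sigma.ι g p.1)
      (fun p => Sigma.π g p.1 ≫ (e p.1).hom ≫ Sigma.π (E p.1) p.2) (by simp [F]) ?_
      (fun p => (hE p.1 p.2).1)
    rintro ⟨i, t⟩ ⟨i', t'⟩ hne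
    by_cases hi : i = i'
    · subst hi
      have ht : t ≠ t' := fun h => hne (by rw [h])
      simp [Sigma.ι_π_of_ne _ ht]
    · simp [Sigma.ι_π_of_ne_assoc _ hi]
  have : HasCoproduct F := by
    have := hasColimitsOfShape_of_equivalence (C := C)
      (Discrete.equivalence (equivShrink.{v} (Σ i, T i)).symm)
    infer_instance
  obtain ⟨S, ε, ⟨e'⟩⟩ := exists_small_iso_sigma F fun p => (hE p.1 p.2).1
  have (s : S) : Injective ((F ∘ ε) s) := hinj _ _
  have := injective_sigma_of_indecomposable h' (F ∘ ε) fun s => hE _ _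
  have : Injective (∐ F) := Injective.of_iso e'.symm this
  refine Retract.injective (Y := ∐ F)
    { i := Sigma.desc fun i => (e i).hom ≫ Sigma.desc fun t => Sigma.ι F ⟨i, t⟩
      r := Sigma.desc fun p => Sigma.ι (E p.1) p.2 ≫ (e p.1).inv ≫ Sigma.ι g p.1
      retract := ?_ }
  refine Sigma.hom_ext _ _ fun i => ?_
  rw [← cancel_epi (e i).inv]
  refine Sigma.hom_ext _ _ fun t => ?_
  simp [F]
end

section
/- Let 𝒮 ⊆ 𝒜 be a set of arcs having a minimal element (l,m) with respect to the lexicographic order on arcs (where (a,b) < (c,d) iff a < c, or a = c and b < d). Then for every arc (a,b) ∈ 𝒮 with (a,b) ≠ (l,m), the space of degree-0 graded S-module homomorphisms Hom_{gr S}(M_{(a,b)}, M_{(l,m)}) is zero. -/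
universe u

theorem arcComp_eq_top {k : Type u} [Field k] {a b : Zb} {i : ℤ}
    (ha : a < ((-i : ℤ) : Zb)) (hb : ((-i : ℤ) : Zb) ≤ b) : arcComp k a b i = ⊤ :=
  if_pos ⟨ha, hb⟩

theorem arcComp_eq_bot {k : Type u} [Field k] {a b : Zb} {i : ℤ}
    (h : ¬ (a < ((-i : ℤ) : Zb) ∧ ((-i : ℤ) : Zb) ≤ b)) : arcComp k a b i = ⊥ :=
  if_neg h

theorem arcMod_eq_zero {k : Type u} [Field k] {a b : Zb} {i : ℤ}
    (h : ¬ (a < ((-i : ℤ) : Zb) ∧ ((-i : ℤ) : Zb) ≤ b)) (x : (arcMod k a b).V i) : x = 0 := by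
  obtain ⟨x, hx⟩ := x
  rw [arcComp_eq_bot h, Submodule.mem_bot] at hx
  exact Subtype.ext hx

theorem arcMod_act_val {k : Type u} [Field k] {a b : Zb} {i : ℤ}
    (h : arcComp k a b (i + 1) = ⊤) (x : arcComp k a b i) :
    ((show arcComp k a b (i + 1) from (arcMod k a b).act i x) : k) = x := by
  simp only [arcMod, dif_pos h]
  rfl

/-- `y` acts injectively on `M_{(a,b)}` in degree `i` as long as `a < -(i + 1)`. -/
theorem arcMod_act_injective {k : Type u} [Field k] {a b : Zb} {i : ℤ}
    (ha : a < ((-(i + 1) : ℤ) : Zb)) : Function.Injective ((arcMod k a b).act i) := by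
  by_cases hb : ((-i : ℤ) : Zb) ≤ b
  · have htop : arcComp k a b (i + 1) = ⊤ :=
      arcComp_eq_top ha (le_trans (WithBot.coe_le_coe.2 (by omega)) hb)
    intro x y hxy
    apply Subtype.ext
    rw [← arcMod_act_val htop x, ← arcMod_act_val htop y, hxy]
  · intro x y _
    rw [arcMod_eq_zero (fun h => hb h.2) x, arcMod_eq_zero (fun h => hb h.2) y]

/-- `y` maps `M_{(a,b)}` onto its degree `i + 1` component as long as `-i ≤ b`. -/
theorem arcMod_act_surjective {k : Type u} [Field k] {a b : Zb} {i : ℤ}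
    (hb : ((-i : ℤ) : Zb) ≤ b) : Function.Surjective ((arcMod k a b).act i) := by
  intro x
  by_cases ha : a < ((-(i + 1) : ℤ) : Zb)
  · have hle : ((-(i + 1) : ℤ) : Zb) ≤ ((-i : ℤ) : Zb) := WithBot.coe_le_coe.2 (by omega)
    have htop : arcComp k a b i = ⊤ := arcComp_eq_top (lt_of_lt_of_le ha hle) hb
    refine ⟨⟨x.1, htop ▸ Submodule.mem_top⟩, Subtype.ext ?_⟩
    exact arcMod_act_val (arcComp_eq_top ha (hle.trans hb)) _
  · exact ⟨0, by rw [map_zero, arcMod_eq_zero (fun h => ha h.1) x]⟩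

/-- There are no nonzero morphisms `M_{(a,b)} → M_{(l,m)}` if `l < a`. -/
theorem grHom_arcMod_eq_bot_of_left_lt {k : Type u} [Field k] {a b l m : Zb} (h : l < a) :
    grHom k (arcMod k a b) (arcMod k l m) = ⊥ := by
  obtain ⟨a, rfl⟩ := WithBot.ne_bot_iff_exists.1 (ne_bot_of_gt h)
  refine (Submodule.eq_bot_iff _).2 fun f hf => ?_
  have key : ∀ (n : ℕ) (i : ℤ), -i ≤ a + n → f i = 0 := by
    intro n
    induction n with
    | zero =>
      intro i hi
      ext x
      rw [arcMod_eq_zero (fun hx => absurd (WithBot.coe_lt_coe.1 hx.1) (by omega)) x,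
        map_zero, map_zero]
    | succ n ih =>
      intro i hi
      by_cases hi' : -i ≤ a + n
      · exact ih i hi'
      refine LinearMap.ext fun x => ?_
      have hl : l < ((-(i + 1) : ℤ) : Zb) :=
        lt_of_lt_of_le h (WithBot.coe_le_coe.2 (by omega))
      apply arcMod_act_injective hl
      have hx := LinearMap.congr_fun (hf i) x
      rw [ih (i + 1) (by omega)] at hx
      exact hx.trans (map_zero _).symm
  exact funext fun i => key (-i - a).toNat i (by omega)

/-- There are no nonzero morphisms `M_{(a,b)} → M_{(l,m)}` if `m < b`. -/
theorem grHom_arcMod_eq_bot_of_right_lt {k : Type u} [Field k] {a b l m : Zb} (h : m < b) :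
    grHom k (arcMod k a b) (arcMod k l m) = ⊥ := by
  obtain ⟨b, rfl⟩ := WithBot.ne_bot_iff_exists.1 (ne_bot_of_gt h)
  refine (Submodule.eq_bot_iff _).2 fun f hf => ?_
  have key : ∀ (n : ℕ) (i : ℤ), b - n ≤ -i → f i = 0 := by
    intro n
    induction n with
    | zero =>
      intro i hi
      refine LinearMap.ext fun x => arcMod_eq_zero (fun hx => ?_) _
      exact absurd (lt_of_le_of_lt hx.2 h) (not_lt.2 (WithBot.coe_le_coe.2 (by omega)))
    | succ n ih =>
      intro i hi
      by_cases hi' : b - n ≤ -i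
      · exact ih i hi'
      obtain ⟨j, rfl⟩ : ∃ j, i = j + 1 := ⟨i - 1, by omega⟩
      refine LinearMap.ext fun x => ?_
      obtain ⟨x, rfl⟩ := arcMod_act_surjective (k := k) (a := a) (b := (b : Zb)) (i := j)
        (WithBot.coe_le_coe.2 (by omega)) x
      have hx := LinearMap.congr_fun (hf j) x
      rw [ih j (by omega)] at hx
      exact hx.symm.trans (map_zero ((arcMod k l m).act j))
  exact funext fun i => key (b + i).toNat i (by omega)

/-- If a set of arcs `𝒮` has a lexicographically minimal element `(l,m)`,
then for every arc `(a,b) ∈ 𝒮` different from `(l,m)` the space of degree-0 graded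
`S`-module homomorphisms `Hom_{gr S}(M_{(a,b)}, M_{(l,m)})` is zero. -/
theorem stmt18 (k : Type u) [Field k] (S : Set (Zb × Zb)) (hS : ∀ p ∈ S, p.1 < p.2)
    (l m : Zb) (hlm : (l, m) ∈ S)
    (hmin : ∀ p ∈ S, l < p.1 ∨ (l = p.1 ∧ m ≤ p.2))
    (a b : Zb) (hab : (a, b) ∈ S) (hne : (a, b) ≠ (l, m)) :
    grHom k (arcMod k a b) (arcMod k l m) = ⊥ := by
  rcases hmin _ hab with h | ⟨rfl, h⟩
  · exact grHom_arcMod_eq_bot_of_left_lt h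
  · exact grHom_arcMod_eq_bot_of_right_lt (lt_of_le_of_ne h fun h' => hne (by rw [h']))
end
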